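/- arXiv:solv-int/9501002 — 9 statements merged into one kernel-verified Lean document; each statement's English description precedes it below -/
import Mathlib

section
/- Let ε ∈ ℂ and let u : ℝ → ℂ be three times differentiable. Then the zero-curvature equation ∂ₓΛ(x,λ) − ε·∂_λQ(x,λ) = −(Λ(x,λ)·Q(x,λ) − Q(x,λ)·Λ(x,λ)) holds for all x ∈ ℝ and all λ ∈ ℂ if and only if u'''(x) − 6·u(x)·u'(x) = ε for all x ∈ ℝ. -/
/-- The Lax matrix `Λ(x,λ)` of the string equation:
`Λ = [[a, b], [c, -a]]` with `a = -u'`, `b = 2u + 4λ`,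
`c = -4λ² + 2λu + 2u² - u''`. -/
noncomputable def LaxLambda (u : ℝ → ℂ) (x : ℝ) (l : ℂ) : Matrix (Fin 2) (Fin 2) ℂ :=
  !![-(deriv u x), 2 * u x + 4 * l;
     -4 * l ^ 2 + 2 * l * u x + 2 * (u x) ^ 2 - deriv (deriv u) x, deriv u x]

/-- The matrix `Q(x,λ) = [[0, 1], [u(x) - λ, 0]]`. -/
def LaxQ (u : ℝ → ℂ) (x : ℝ) (l : ℂ) : Matrix (Fin 2) (Fin 2) ℂ :=
  !![0, 1; u x - l, 0]

/-- The entrywise `x`-derivative of `LaxLambda`. -/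
theorem deriv_LaxLambda (u : ℝ → ℂ) (hu : Differentiable ℝ u)
    (hu'' : Differentiable ℝ (deriv (deriv u)))
    (x : ℝ) (l : ℂ) :
    (Matrix.of fun i j => deriv (fun t : ℝ => LaxLambda u t l i j) x) =
      !![-(deriv (deriv u) x), 2 * deriv u x;
         2 * l * deriv u x + 4 * u x * deriv u x - deriv (deriv (deriv u)) x,
         deriv (deriv u) x] := by
  have h₀ := (hu x).hasDerivAt
  have h₂ := (hu'' x).hasDerivAt
  ext i j
  fin_cases i <;> fin_cases j
  · simp [LaxLambda]
  · simp [LaxLambda]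
  · have h := ((((h₀.const_mul (2 * l)).const_add (-4 * l ^ 2)).add
      ((h₀.pow 2).const_mul 2)).sub h₂).deriv
    refine Eq.trans h ?_
    simp
    ring
  · simp [LaxLambda]

/-- The entrywise `λ`-derivative of `LaxQ`. -/
theorem deriv_LaxQ (u : ℝ → ℂ) (x : ℝ) (l : ℂ) :
    (Matrix.of fun i j => deriv (fun m : ℂ => LaxQ u x m i j) l) = !![0, 0; -1, 0] := by
  ext i j
  fin_cases i <;> fin_cases j <;> simp [LaxQ]

/-- The commutator of the Lax pair is free of `λ` except in its lower left entry. -/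
theorem LaxLambda_commutator_LaxQ (u : ℝ → ℂ) (x : ℝ) (l : ℂ) :
    LaxLambda u x l * LaxQ u x l - LaxQ u x l * LaxLambda u x l =
      !![deriv (deriv u) x, -2 * deriv u x;
         2 * deriv u x * (u x - l), -(deriv (deriv u) x)] := by
  ext i j
  fin_cases i <;> fin_cases j <;> simp [LaxLambda, LaxQ] <;> ring

/-- The zero-curvature equation `∂ₓΛ - ε ∂_λ Q = -[Λ, Q]` holds for all `x, λ`
iff `u''' - 6 u u' = ε`. -/
theorem string_equation_zero_curvature (ε : ℂ) (u : ℝ → ℂ)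
    (hu : Differentiable ℝ u) (hu' : Differentiable ℝ (deriv u))
    (hu'' : Differentiable ℝ (deriv (deriv u))) :
    (∀ (x : ℝ) (l : ℂ),
        (Matrix.of fun i j => deriv (fun t : ℝ => LaxLambda u t l i j) x)
          - ε • (Matrix.of fun i j => deriv (fun m : ℂ => LaxQ u x m i j) l)
        = -(LaxLambda u x l * LaxQ u x l - LaxQ u x l * LaxLambda u x l))
      ↔ (∀ x : ℝ, deriv (deriv (deriv u)) x - 6 * u x * deriv u x = ε) := by
  have key (x : ℝ) (l : ℂ) :
      (Matrix.of fun i j => deriv (fun t : ℝ => LaxLambda u t l i j) x)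
          - ε • (Matrix.of fun i j => deriv (fun m : ℂ => LaxQ u x m i j) l)
        = -(LaxLambda u x l * LaxQ u x l - LaxQ u x l * LaxLambda u x l)
      ↔ deriv (deriv (deriv u)) x - 6 * u x * deriv u x = ε := by
    rw [deriv_LaxLambda u hu hu'', deriv_LaxQ, LaxLambda_commutator_LaxQ]
    constructor
    · intro h
      have h₁₀ := congrFun (congrFun h 1) 0
      simp at h₁₀
      linear_combination -h₁₀
    · intro h
      ext i j
      fin_cases i <;> fin_cases j <;> simp
      linear_combination -h
  simp only [key, forall_const]
end

section
/- Let δ be the unique derivation of the polynomial ring ℚ[v, v₁, v₂, ε] with δ(v) = v₁, δ(v₁) = v₂, δ(v₂) = 6vv₁ + ε, δ(ε) = 0 (the Painlevé-1 flow), and let ∂ be the unique derivation of ℚ[p, q, g₂, g₃] with ∂(p) = q, ∂(q) = 6p² − g₂/2, ∂(g₂) = ∂(g₃) = 0 (the Weierstrass ℘ flow). Let σ : ℚ[p, q, g₂, g₃] → ℚ[v, v₁, v₂] be the algebra map with σ(p) = v/2, σ(q) = v₁/2, σ(g₂) = 3v² − v₂, σ(g₃) = −v³ + vv₂/2 − v₁²/4.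 Then for every n ≥ 0 there exist finitely many polynomials P_{i,n} ∈ ℤ[v, v₁, v₂] (i ≥ 1), each weighted-homogeneous of degree n + 2 − 5i with respect to the weights w(v) = 2, w(v₁) = 3, w(v₂) = 4, such that δⁿ(v) = 2σ(∂ⁿ(p)) + Σ_{i≥1} P_{i,n}·εⁱ in ℚ[v, v₁, v₂, ε]. In particular 2σ(∂ⁿ(p)) has integer coefficients. -/
open MvPolynomial

/-- The embedding `ℤ[v, v₁, v₂] → ℚ[v, v₁, v₂, ε]` sending the three variables
to the first three variables. -/
noncomputable def embP13 : MvPolynomial (Fin 3) ℤ →ₐ[ℤ] MvPolynomial (Fin 4) ℚ :=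
  MvPolynomial.aeval (fun i : Fin 3 => (MvPolynomial.X (Fin.castSucc i) : MvPolynomial (Fin 4) ℚ))

/-- The derivation of `ℤ[v, v₁, v₂]` with `v ↦ v₁ ↦ v₂ ↦ 6vv₁`: the Painlevé-1 flow at `ε = 0`. -/
noncomputable def stationaryFlow :
    Derivation ℤ (MvPolynomial (Fin 3) ℤ) (MvPolynomial (Fin 3) ℤ) :=
  (X 1 : MvPolynomial (Fin 3) ℤ) • pderiv 0 + (X 2 : MvPolynomial (Fin 3) ℤ) • pderiv 1 +
    (C 6 * X 0 * X 1 : MvPolynomial (Fin 3) ℤ) • pderiv 2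

/-- The coefficient of `εⁱ` in the `n`-th derivative of `v` along the Painlevé-1 flow. -/
noncomputable def flowCoeff : ℕ → ℕ → MvPolynomial (Fin 3) ℤ
  | 0, 0 => X 0
  | 0, _ + 1 => 0
  | n + 1, 0 => stationaryFlow (flowCoeff n 0)
  | n + 1, i + 1 => stationaryFlow (flowCoeff n (i + 1)) + pderiv 2 (flowCoeff n i)

lemma isWeightedHomogeneous_stationaryFlow {P : MvPolynomial (Fin 3) ℤ} {k l : ℤ}
    (h : IsWeightedHomogeneous (![2, 3, 4] : Fin 3 → ℤ) P k) (hl : l = k + 1) :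
    IsWeightedHomogeneous (![2, 3, 4] : Fin 3 → ℤ) (stationaryFlow P) l := by
  have hX := isWeightedHomogeneous_X ℤ (![2, 3, 4] : Fin 3 → ℤ)
  have h0 := (hX 1).mul (h.pderiv (i := 0) (n' := k - 2) (by simp))
  have h1 := (hX 2).mul (h.pderiv (i := 1) (n' := k - 3) (by simp))
  have h2 := (((hX 0).C_mul 6).mul (hX 1)).mul (h.pderiv (i := 2) (n' := k - 4) (by simp))
  rw [show (![2, 3, 4] : Fin 3 → ℤ) 1 + (k - 2) = l by simp; lia] at h0
  rw [show (![2, 3, 4] : Fin 3 → ℤ) 2 + (k - 3) = l by simp; lia] at h1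
  rw [show (![2, 3, 4] : Fin 3 → ℤ) 0 + (![2, 3, 4] : Fin 3 → ℤ) 1 + (k - 4) = l by
    simp; lia] at h2
  exact (h0.add h1).add h2

lemma isWeightedHomogeneous_flowCoeff (n i : ℕ) :
    IsWeightedHomogeneous (![2, 3, 4] : Fin 3 → ℤ) (flowCoeff n i) (n + 2 - 5 * i) := by
  induction n generalizing i with
  | zero =>
    cases i with
    | zero => simpa [flowCoeff] using isWeightedHomogeneous_X ℤ (![2, 3, 4] : Fin 3 → ℤ) 0
    | succ i => exact isWeightedHomogeneous_zero ..
  | succ n ih =>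
    cases i with
    | zero => exact isWeightedHomogeneous_stationaryFlow (ih 0) (by push_cast; ring)
    | succ i =>
      exact (isWeightedHomogeneous_stationaryFlow (ih (i + 1)) (by push_cast; ring)).add
        ((ih i).pderiv (by simp; ring))

/-- Homogeneity for natural weights can be tested after casting the weights to `ℤ`. -/
lemma MvPolynomial.IsWeightedHomogeneous.of_intCast {σ R : Type*} [CommSemiring R] {w : σ → ℕ}
    {P : MvPolynomial σ R} {a b : ℕ} (hP : P ≠ 0)
    (h : IsWeightedHomogeneous (fun i => (w i : ℤ)) P (a - b)) :
    b ≤ a ∧ IsWeightedHomogeneous w P (a - b) := by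
  have key : ∀ m, coeff m P ≠ 0 → Finsupp.weight w m + b = a := by
    intro m hm
    have := h hm
    simp only [Finsupp.weight_apply, Finsupp.sum, smul_eq_mul, nsmul_eq_mul] at this ⊢
    zify
    linarith
  obtain ⟨m, hm⟩ := MvPolynomial.ne_zero_iff.mp hP
  refine ⟨by have := key m hm; lia, fun m hm => ?_⟩
  have := key m hm
  lia

lemma flowCoeff_eq_zero_of_lt {n i : ℕ} (h : n < i) : flowCoeff n i = 0 := by
  induction n generalizing i with
  | zero =>
    cases i with
    | zero => lia
    | succ i => rfl
  | succ n ih =>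
    cases i with
    | zero => lia
    | succ i => simp [flowCoeff, ih (show n < i + 1 by lia), ih (show n < i by lia)]

lemma exists_coeff_embP13_eq_intCast (P : MvPolynomial (Fin 3) ℤ) (m : Fin 4 →₀ ℕ) :
    ∃ z : ℤ, (embP13 P).coeff m = z := by
  have h : embP13 P = map (Int.castRingHom ℚ) (rename Fin.castSucc P) := by
    induction P using MvPolynomial.induction_on with
    | C a => simp [embP13]
    | add p q hp hq => simp only [map_add, hp, hq]
    | mul_X p i hp => rw [map_mul, hp]; simp [embP13]
  exact ⟨_, by rw [h, coeff_map]; rfl⟩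

/-- A derivation with `v ↦ v₁ ↦ v₂ ↦ 6vv₁ + t` on polynomials in `v, v₁, v₂`. -/
lemma derivation_embP13 {t : MvPolynomial (Fin 4) ℚ}
    (δ : Derivation ℚ (MvPolynomial (Fin 4) ℚ) (MvPolynomial (Fin 4) ℚ))
    (hδ0 : δ (X 0) = X 1) (hδ1 : δ (X 1) = X 2) (hδ2 : δ (X 2) = 6 * X 0 * X 1 + t)
    (P : MvPolynomial (Fin 3) ℤ) :
    δ (embP13 P) = embP13 (stationaryFlow P) + embP13 (pderiv 2 P) * t := by
  have hX (i : Fin 3) : embP13 (X i) = X i.castSucc := aeval_X ..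
  have hC (a : ℤ) : embP13 (C a) = a := by simp [embP13]
  induction P using MvPolynomial.induction_on with
  | C a => rw [hC]; simp
  | add p q hp hq => simp only [map_add, hp, hq]; ring
  | mul_X p i hp =>
    have hi : δ (X i.castSucc) = embP13 (stationaryFlow (X i)) + embP13 (pderiv 2 (X i)) * t := by
      fin_cases i <;> simp [stationaryFlow, hX, hδ0, hδ1, hδ2, pderiv_X, map_ofNat]
    simp only [map_mul, map_add, Derivation.leibniz, hX, smul_eq_mul, hp, hi]
    ring

lemma iterate_derivation_X_zero
    (δ : Derivation ℚ (MvPolynomial (Fin 4) ℚ) (MvPolynomial (Fin 4) ℚ))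
    (hδ0 : δ (X 0) = X 1) (hδ1 : δ (X 1) = X 2)
    (hδ2 : δ (X 2) = 6 * X 0 * X 1 + X 3) (hδ3 : δ (X 3) = 0) (n : ℕ) :
    (⇑δ)^[n] (X 0) = ∑ i ∈ Finset.range (n + 1), embP13 (flowCoeff n i) * (X 3) ^ i := by
  induction n with
  | zero => simp [flowCoeff, embP13]
  | succ n ih =>
    have hstep (i : ℕ) : δ (embP13 (flowCoeff n i) * X 3 ^ i) =
        embP13 (stationaryFlow (flowCoeff n i)) * X 3 ^ i +
          embP13 (pderiv 2 (flowCoeff n i)) * X 3 ^ (i + 1) := by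
      rw [Derivation.leibniz, Derivation.leibniz_pow, hδ3,
        derivation_embP13 δ hδ0 hδ1 hδ2, smul_eq_mul, smul_eq_mul]
      simp
      ring
    have hlast : embP13 (stationaryFlow (flowCoeff n (n + 1))) *
        (X 3 : MvPolynomial (Fin 4) ℚ) ^ (n + 1) = 0 := by
      simp [flowCoeff_eq_zero_of_lt]
    have hshift := Finset.sum_range_succ'
      (fun i => embP13 (stationaryFlow (flowCoeff n i)) * X 3 ^ i) (n + 1)
    rw [Finset.sum_range_succ, hlast, add_zero] at hshift
    rw [Function.iterate_succ_apply', ih, map_sum, Finset.sum_range_succ' _ (n + 1)]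
    simp only [hstep, Finset.sum_add_distrib, flowCoeff, map_add, add_mul, hshift]
    ring

/-- The substitution `σ` intertwines the Weierstrass flow with the Painlevé-1 flow at `ε = 0`. -/
lemma two_mul_map_iterate_derivation
    (δ : Derivation ℚ (MvPolynomial (Fin 4) ℚ) (MvPolynomial (Fin 4) ℚ))
    (hδ0 : δ (X 0) = X 1) (hδ1 : δ (X 1) = X 2) (hδ2 : δ (X 2) = 6 * X 0 * X 1)
    (D : Derivation ℚ (MvPolynomial (Fin 4) ℚ) (MvPolynomial (Fin 4) ℚ))
    (hD0 : D (X 0) = X 1) (hD1 : D (X 1) = 6 * X 0 ^ 2 - C (1/2 : ℚ) * X 2)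
    (hD2 : D (X 2) = 0) (hD3 : D (X 3) = 0)
    (σ : MvPolynomial (Fin 4) ℚ →ₐ[ℚ] MvPolynomial (Fin 4) ℚ)
    (hσ0 : σ (X 0) = C (1/2 : ℚ) * X 0) (hσ1 : σ (X 1) = C (1/2 : ℚ) * X 1)
    (hσ2 : σ (X 2) = 3 * X 0 ^ 2 - X 2)
    (hσ3 : σ (X 3) = -(X 0) ^ 3 + C (1/2 : ℚ) * X 0 * X 2 - C (1/4 : ℚ) * X 1 ^ 2)
    (n : ℕ) : 2 * σ ((⇑D)^[n] (X 0)) = embP13 (flowCoeff n 0) := by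
  have hC (a : ℚ) : σ (C a) = C a := σ.commutes a
  have hhalf : (2 : MvPolynomial (Fin 4) ℚ) * C (1 / 2) = 1 := by
    rw [show (2 : MvPolynomial (Fin 4) ℚ) = C 2 from rfl, ← C_mul]; norm_num
  have hquarter : (2 : MvPolynomial (Fin 4) ℚ) * C (1 / 4) = C (1 / 2) := by
    rw [show (2 : MvPolynomial (Fin 4) ℚ) = C 2 from rfl, ← C_mul]; norm_num
  have hnum (k : ℕ) [k.AtLeastTwo] :
      δ (OfNat.ofNat k : MvPolynomial (Fin 4) ℚ) = 0 := δ.map_natCast k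
  have hσD (f : MvPolynomial (Fin 4) ℚ) : σ (D f) = δ (σ f) := by
    induction f using MvPolynomial.induction_on with
    | C a => simp [hC]
    | add p q hp hq => simp only [map_add, hp, hq]
    | mul_X p i hp =>
      have hi : σ (D (X i)) = δ (σ (X i)) := by
        fin_cases i
        · simp [hD0, hσ0, hσ1, hδ0]
        · simp only [Fin.mk_one, hD1, hσ0, hσ1, hσ2, map_sub, map_mul, map_pow, map_ofNat, hC,
            Derivation.leibniz, derivation_C, hδ1, smul_eq_mul]
          linear_combination (3 * X 0 ^ 2 * C (1 / 2)) * hhalf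
        · simp [hD2, hσ2, hδ0, hδ2, hnum]
          ring
        · simp only [Fin.reduceFinMk, hD3, hσ3, map_zero, map_sub, map_add, map_neg,
            Derivation.leibniz, Derivation.leibniz_pow, derivation_C, hδ0, hδ1, hδ2,
            smul_eq_mul, nsmul_eq_mul]
          push_cast
          linear_combination (-3 * X 0 ^ 2 * X 1) * hhalf + X 1 * X 2 * hquarter
      simp only [map_mul, map_add, Derivation.leibniz, smul_eq_mul, hp, hi]
  have hδ2' : δ (X 2) = 6 * X 0 * X 1 + 0 := by rw [hδ2, add_zero]
  induction n with
  | zero =>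
    simp only [Function.iterate_zero, id, hσ0, flowCoeff, embP13, aeval_X, Fin.castSucc_zero]
    linear_combination X 0 * hhalf
  | succ n ih =>
    have h2 := δ.leibniz 2 (σ ((⇑D)^[n] (X 0)))
    rw [ih, derivation_embP13 δ hδ0 hδ1 hδ2', hnum] at h2
    simp only [Function.iterate_succ_apply', hσD, flowCoeff]
    simpa using h2.symm

/-- Let `δ` be the derivation of `ℚ[v, v₁, v₂, ε]` (variables `X 0, X 1, X 2, X 3`)
with `δv = v₁`, `δv₁ = v₂`, `δv₂ = 6vv₁ + ε`, `δε = 0` (the Painlevé-1 flow), and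
`∂` the derivation of `ℚ[p, q, g₂, g₃]` (variables `X 0, X 1, X 2, X 3`) with
`∂p = q`, `∂q = 6p² - g₂/2`, `∂g₂ = ∂g₃ = 0` (the Weierstrass `℘` flow).
Let `σ` be the algebra map with `σp = v/2`, `σq = v₁/2`, `σg₂ = 3v² - v₂`,
`σg₃ = -v³ + vv₂/2 - v₁²/4` (its image avoids `ε`).  Then for each `n` there are
polynomials `P i ∈ ℤ[v, v₁, v₂]` (`i ≥ 1`), each weighted-homogeneous of degree
`n + 2 - 5i` for the weights `(2, 3, 4)` (in particular zero unless `5i ≤ n + 2`),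
with `δⁿ v = 2 σ(∂ⁿ p) + Σ_{i ≥ 1} P i · εⁱ`; moreover `2 σ(∂ⁿ p)` has integer
coefficients. -/
theorem string_equation_elliptic_substitution
    (δ : Derivation ℚ (MvPolynomial (Fin 4) ℚ) (MvPolynomial (Fin 4) ℚ))
    (hδ0 : δ (X 0) = X 1) (hδ1 : δ (X 1) = X 2)
    (hδ2 : δ (X 2) = 6 * X 0 * X 1 + X 3) (hδ3 : δ (X 3) = 0)
    (D : Derivation ℚ (MvPolynomial (Fin 4) ℚ) (MvPolynomial (Fin 4) ℚ))
    (hD0 : D (X 0) = X 1) (hD1 : D (X 1) = 6 * X 0 ^ 2 - C (1/2 : ℚ) * X 2)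
    (hD2 : D (X 2) = 0) (hD3 : D (X 3) = 0)
    (σ : MvPolynomial (Fin 4) ℚ →ₐ[ℚ] MvPolynomial (Fin 4) ℚ)
    (hσ0 : σ (X 0) = C (1/2 : ℚ) * X 0) (hσ1 : σ (X 1) = C (1/2 : ℚ) * X 1)
    (hσ2 : σ (X 2) = 3 * X 0 ^ 2 - X 2)
    (hσ3 : σ (X 3) = -(X 0) ^ 3 + C (1/2 : ℚ) * X 0 * X 2 - C (1/4 : ℚ) * X 1 ^ 2)
    (n : ℕ) :
    ∃ P : ℕ → MvPolynomial (Fin 3) ℤ,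
      (∀ i : ℕ, 1 ≤ i → P i ≠ 0 →
        5 * i ≤ n + 2 ∧
          MvPolynomial.IsWeightedHomogeneous ![2, 3, 4] (P i) (n + 2 - 5 * i)) ∧
      (⇑δ)^[n] (X 0)
        = 2 * σ ((⇑D)^[n] (X 0)) + ∑ i ∈ Finset.Icc 1 n, embP13 (P i) * (X 3) ^ i ∧
      (∀ m : Fin 4 →₀ ℕ, ∃ z : ℤ, (2 * σ ((⇑D)^[n] (X 0))).coeff m = (z : ℚ)) := by
  refine ⟨flowCoeff n, fun i _ hP => ?_, ?_, fun m => ?_⟩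
  · refine IsWeightedHomogeneous.of_intCast hP ?_
    convert isWeightedHomogeneous_flowCoeff n i using 1
    · funext j
      fin_cases j <;> rfl
    · push_cast
      ring
  all_goals
    have hσD := two_mul_map_iterate_derivation
      (δ - (X 3 : MvPolynomial (Fin 4) ℚ) • pderiv 2) (by simp [hδ0, pderiv_X])
      (by simp [hδ1, pderiv_X]) (by simp [hδ2, pderiv_X])
      D hD0 hD1 hD2 hD3 σ hσ0 hσ1 hσ2 hσ3 n
    rw [hσD]
  · rw [iterate_derivation_X_zero δ hδ0 hδ1 hδ2 hδ3, Finset.range_eq_Ico,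
      Finset.sum_eq_sum_Ico_succ_bot n.succ_pos]
    simp [Finset.Ico_add_one_right_eq_Icc]
  · exact exists_coeff_embP13_eq_intCast _ m
end

section
/- Let Ω ⊆ ℂ be open, λ₀ ∈ Ω, and let a, b, c, y : Ω → ℂ be differentiable at λ₀ with y(λ)² = a(λ)² + b(λ)c(λ) on Ω, b(λ₀) ≠ 0 and y(λ₀) ≠ 0. Set R = a² + bc, χ₊ = (−a − y)/b, χ₋ = (−a + y)/b, U(λ) = [[1, 1], [χ₋(λ), χ₊(λ)]]. Then U(λ₀) is invertible and the diagonal entries of U(λ₀)⁻¹·U'(λ₀) are: entry (1,1) equals (R'/(4R) − b'/(2b))(λ₀) − ((a/b)'·b/(2y))(λ₀), and entry (2,2) equals (R'/(4R) − b'/(2b))(λ₀) + ((a/b)'·b/(2y))(λ₀). -/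
/-- Diagonal entries of `U⁻¹ U_λ` for the diagonalizing matrix
`U(λ) = [[1, 1], [χ₋(λ), χ₊(λ)]]`, `χ± = (-a ∓ y)/b`, where `y² = a² + bc = R`
on an open set: entry `(1,1)` is `(R'/(4R) - b'/(2b)) - (a/b)'·b/(2y)` and entry
`(2,2)` is `(R'/(4R) - b'/(2b)) + (a/b)'·b/(2y)` at `l₀`. -/
theorem semiclassical_B0_correction (Ω : Set ℂ) (hΩ : IsOpen Ω) (l₀ : ℂ) (hl₀ : l₀ ∈ Ω)
    (a b c y : ℂ → ℂ)
    (ha : DifferentiableAt ℂ a l₀) (hb : DifferentiableAt ℂ b l₀)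
    (hc : DifferentiableAt ℂ c l₀) (hy : DifferentiableAt ℂ y l₀)
    (hsq : ∀ l ∈ Ω, (y l) ^ 2 = (a l) ^ 2 + b l * c l)
    (hb0 : b l₀ ≠ 0) (hy0 : y l₀ ≠ 0) :
    IsUnit (!![1, 1; (-(a l₀) + y l₀) / b l₀, (-(a l₀) - y l₀) / b l₀]
      : Matrix (Fin 2) (Fin 2) ℂ) ∧
    ((!![1, 1; (-(a l₀) + y l₀) / b l₀, (-(a l₀) - y l₀) / b l₀]
        : Matrix (Fin 2) (Fin 2) ℂ)⁻¹
      * Matrix.of (fun i j =>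
          deriv (fun l : ℂ =>
            (!![1, 1; (-(a l) + y l) / b l, (-(a l) - y l) / b l]
              : Matrix (Fin 2) (Fin 2) ℂ) i j) l₀)) 0 0
      = (deriv (fun l => (a l) ^ 2 + b l * c l) l₀ / (4 * ((a l₀) ^ 2 + b l₀ * c l₀))
          - deriv b l₀ / (2 * b l₀))
        - deriv (fun l => a l / b l) l₀ * b l₀ / (2 * y l₀) ∧
    ((!![1, 1; (-(a l₀) + y l₀) / b l₀, (-(a l₀) - y l₀) / b l₀]
        : Matrix (Fin 2) (Fin 2) ℂ)⁻¹
      * Matrix.of (fun i j =>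
          deriv (fun l : ℂ =>
            (!![1, 1; (-(a l) + y l) / b l, (-(a l) - y l) / b l]
              : Matrix (Fin 2) (Fin 2) ℂ) i j) l₀)) 1 1
      = (deriv (fun l => (a l) ^ 2 + b l * c l) l₀ / (4 * ((a l₀) ^ 2 + b l₀ * c l₀))
          - deriv b l₀ / (2 * b l₀))
        + deriv (fun l => a l / b l) l₀ * b l₀ / (2 * y l₀) := by
  have hR : deriv (fun l => (a l) ^ 2 + b l * c l) l₀ = 2 * y l₀ * deriv y l₀ := by
    have h : (fun l => (a l) ^ 2 + b l * c l) =ᶠ[nhds l₀] fun l => (y l) ^ 2 :=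
      Filter.eventuallyEq_of_mem (hΩ.mem_nhds hl₀) fun l hl => (hsq l hl).symm
    rw [h.deriv_eq]
    simpa using (hy.hasDerivAt.fun_pow 2).deriv
  have hab : deriv (fun l => a l / b l) l₀
      = (deriv a l₀ * b l₀ - a l₀ * deriv b l₀) / b l₀ ^ 2 :=
    (ha.hasDerivAt.fun_div hb.hasDerivAt hb0).deriv
  have hχm : deriv (fun l => (-(a l) + y l) / b l) l₀
      = ((-deriv a l₀ + deriv y l₀) * b l₀ - (-(a l₀) + y l₀) * deriv b l₀) / b l₀ ^ 2 :=
    ((ha.hasDerivAt.fun_neg.fun_add hy.hasDerivAt).fun_div hb.hasDerivAt hb0).deriv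
  have hχp : deriv (fun l => (-(a l) - y l) / b l) l₀
      = ((-deriv a l₀ - deriv y l₀) * b l₀ - (-(a l₀) - y l₀) * deriv b l₀) / b l₀ ^ 2 :=
    ((ha.hasDerivAt.fun_neg.fun_sub hy.hasDerivAt).fun_div hb.hasDerivAt hb0).deriv
  have hdet : (!![1, 1; (-(a l₀) + y l₀) / b l₀, (-(a l₀) - y l₀) / b l₀]
      : Matrix (Fin 2) (Fin 2) ℂ).det = -2 * y l₀ / b l₀ := by
    rw [Matrix.det_fin_two_of]
    ring
  refine ⟨?_, ?_, ?_⟩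
  · rw [Matrix.isUnit_iff_isUnit_det, hdet, isUnit_iff_ne_zero]
    simp [hb0, hy0]
  · rw [hR, hab, ← hsq l₀ hl₀, Matrix.inv_def, hdet, Matrix.adjugate_fin_two_of]
    simp [Matrix.mul_apply, Fin.sum_univ_two, hχm]
    field_simp
    ring
  · rw [hR, hab, ← hsq l₀ hl₀, Matrix.inv_def, hdet, Matrix.adjugate_fin_two_of]
    simp [Matrix.mul_apply, Fin.sum_univ_two, hχp]
    field_simp
    ring
end

section
/- Let ε ∈ ℂ, ε ≠ 0, and let u₀, u₁, u₂ ∈ ℂ with u₁ ≠ 0. Set R(λ) = u₁² + (2u₀ + 4λ)(−4λ² + 2λu₀ + 2u₀² − u₂) and λ₀ = −u₀/2. Suppose y is analytic on an open neighbourhood of λ₀ with y(λ)² = R(λ). Define g(λ) = y(λ)/ε + u₁/((u₀ + 2λ)·y(λ)) + 1/(u₀ + 2λ). If y(λ₀) = −u₁, then g extends to a function analytic at λ₀ (no pole). If y(λ₀) = +u₁, then g(λ) − 1/(λ − λ₀) extends analytically to λ₀ (simple pole with residue 1). -/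
/-- Pole structure of `d_λ ln Φ̃ = (y/ε + u₁/((u₀ + 2λ)y) + 1/(u₀ + 2λ)) dλ` at
the point `λ₀ = -u₀/2` over the two sheets of `y² = R(λ)`,
`R(λ) = u₁² + (2u₀ + 4λ)(-4λ² + 2λu₀ + 2u₀² - u₂)`: on the sheet `y(λ₀) = -u₁`
the pole cancels (the function extends analytically), while on the sheet
`y(λ₀) = u₁` there is a simple pole of residue `1`. -/
theorem phi_tilde_log_derivative_poles (ε u₀ u₁ u₂ : ℂ) (hε : ε ≠ 0) (hu₁ : u₁ ≠ 0)
    (V : Set ℂ) (hV : IsOpen V) (hmem : (-u₀ / 2) ∈ V) (y : ℂ → ℂ)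
    (hy : ∀ l ∈ V, AnalyticAt ℂ y l)
    (hsq : ∀ l ∈ V,
      (y l) ^ 2 = u₁ ^ 2 + (2 * u₀ + 4 * l) * (-4 * l ^ 2 + 2 * l * u₀ + 2 * u₀ ^ 2 - u₂)) :
    (y (-u₀ / 2) = -u₁ →
      ∃ h : ℂ → ℂ, AnalyticAt ℂ h (-u₀ / 2) ∧
        (fun l : ℂ => y l / ε + u₁ / ((u₀ + 2 * l) * y l) + 1 / (u₀ + 2 * l))
          =ᶠ[nhdsWithin (-u₀ / 2) {(-u₀ / 2)}ᶜ] h) ∧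
    (y (-u₀ / 2) = u₁ →
      ∃ h : ℂ → ℂ, AnalyticAt ℂ h (-u₀ / 2) ∧
        (fun l : ℂ => y l / ε + u₁ / ((u₀ + 2 * l) * y l) + 1 / (u₀ + 2 * l)
            - 1 / (l - (-u₀ / 2)))
          =ᶠ[nhdsWithin (-u₀ / 2) {(-u₀ / 2)}ᶜ] h) := by
  have hya : AnalyticAt ℂ y (-u₀ / 2) := hy _ hmem
  have hVnhds : ∀ᶠ l in nhdsWithin (-u₀ / 2) {(-u₀ / 2)}ᶜ, l ∈ V :=
    nhdsWithin_le_nhds (hV.mem_nhds hmem)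
  have eventually_ne (c : ℂ) (hc : y (-u₀ / 2) ≠ c) :
      ∀ᶠ l in nhdsWithin (-u₀ / 2) {(-u₀ / 2)}ᶜ, y l ≠ c :=
    nhdsWithin_le_nhds (hya.continuousAt.eventually_ne hc)
  have denom_ne (l : ℂ) (hl : l ≠ -u₀ / 2) : u₀ + 2 * l ≠ 0 := fun h =>
    hl (by linear_combination h / 2)
  refine ⟨fun h0 => ?_, fun h0 => ?_⟩
  · have hy0 : y (-u₀ / 2) ≠ 0 := by simpa [h0] using hu₁
    have hy1 : y (-u₀ / 2) ≠ u₁ := by simpa [h0, neg_eq_self] using hu₁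
    refine ⟨fun l => y l / ε +
      2 * (-4 * l ^ 2 + 2 * l * u₀ + 2 * u₀ ^ 2 - u₂) / (y l * (y l - u₁)), ?_, ?_⟩
    · have hne : y (-u₀ / 2) * (y (-u₀ / 2) - u₁) ≠ 0 := mul_ne_zero hy0 (sub_ne_zero.2 hy1)
      fun_prop (disch := assumption)
    · filter_upwards [hVnhds, eventually_ne _ hy0, eventually_ne _ hy1, self_mem_nhdsWithin]
        with l hlV hl0 hl1 hl
      have ht := denom_ne l hl
      have hs := sub_ne_zero.2 hl1
      have hR := hsq l hlV
      rw [add_assoc]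
      congr 1
      field_simp
      linear_combination hR
  · have hy0 : y (-u₀ / 2) ≠ 0 := by simpa [h0] using hu₁
    have hy1 : y (-u₀ / 2) ≠ -u₁ := by simpa [h0, self_eq_neg] using hu₁
    refine ⟨fun l => y l / ε -
      2 * (-4 * l ^ 2 + 2 * l * u₀ + 2 * u₀ ^ 2 - u₂) / (y l * (y l + u₁)), ?_, ?_⟩
    · have hne : y (-u₀ / 2) * (y (-u₀ / 2) + u₁) ≠ 0 :=
        mul_ne_zero hy0 fun h => hy1 (eq_neg_of_add_eq_zero_left h)
      fun_prop (disch := assumption)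
    · filter_upwards [hVnhds, eventually_ne _ hy0, eventually_ne _ hy1, self_mem_nhdsWithin]
        with l hlV hl0 hl1 hl
      have ht := denom_ne l hl
      have hs : y l + u₁ ≠ 0 := fun h => hl1 (eq_neg_of_add_eq_zero_left h)
      have hR := hsq l hlV
      have hpole : 1 / (l - -u₀ / 2) = 2 / (u₀ + 2 * l) := by
        rw [div_eq_div_iff (sub_ne_zero.2 hl) ht]
        ring
      rw [hpole, add_assoc, add_sub_assoc, sub_eq_add_neg (y l / ε)]
      congr 1
      field_simp
      linear_combination -hR
end

section
/- Let W : ℕ → M₂(ℂ) be a sequence of 2×2 complex matrices such that W₀ is diagonal with (W₀)₁₁ ≠ (W₀)₂₂, and let W₁ᵈ denote the diagonal part of W₁. Then there exist unique sequences A : ℕ → M₂(ℂ) and B : ℕ → M₂(ℂ) with A₀ = Id, B₀ = 0, Aₙ off-diagonal (both diagonal entries zero) for all n ≥ 1, Bₙ diagonal for all n, satisfying for every n ≥ 1 the recursion: AₙW₀ − W₀Aₙ = (n−1)·A_{n−1} − A_{n−1}·W₁ᵈ + Σ_{j=1}^{n−1} j·A_{n−1−j}·B_j + Σ_{j=1}^{n}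 W_j·A_{n−j}. -/
namespace QuasiclassicalRecursion

open Matrix Finset

/-- A sequence defined by a rule whose `n`-th value only sees the earlier values. -/
noncomputable def causalFix {α : Type*} [Inhabited α] (F : ℕ → (ℕ → α) → α) : ℕ → α
  | n => F n fun m => if _h : m < n then causalFix F m else default

/-- A causal rule on sequences has exactly one fixed point. -/
theorem existsUnique_of_causal {α : Type*} [Inhabited α] (F : ℕ → (ℕ → α) → α)
    (hF : ∀ n u v, (∀ m < n, u m = v m) → F n u = F n v) :
    ∃! u : ℕ → α, ∀ n, u n = F n u := by
  refine ⟨causalFix F, fun n => ?_, fun v hv => funext fun n => ?_⟩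
  · rw [causalFix]
    exact hF n _ _ fun m hm => by simp [hm]
  · induction n using Nat.strong_induction_on with
    | _ n ih =>
      rw [hv n, causalFix]
      exact hF n _ _ fun m hm => by simp [hm, ih m hm]

/-- The right-hand side of the recursion. -/
noncomputable def recursionRHS (W A B : ℕ → Matrix (Fin 2) (Fin 2) ℂ) (n : ℕ) :
    Matrix (Fin 2) (Fin 2) ℂ :=
  ((n : ℂ) - 1) • A (n - 1) - A (n - 1) * diagonal (fun i => W 1 i i)
    + (∑ j ∈ Icc 1 (n - 1), (j : ℂ) • (A (n - 1 - j) * B j))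
    + ∑ j ∈ Icc 1 n, W j * A (n - j)

/-- The diagonal coefficients `B`, as forced by the diagonal part of the recursion. -/
noncomputable def diagonalCoeff (W A : ℕ → Matrix (Fin 2) (Fin 2) ℂ) (m : ℕ) :
    Matrix (Fin 2) (Fin 2) ℂ :=
  diagonal fun i => -(m : ℂ)⁻¹ * (∑ j ∈ Icc 1 (m + 1), W j * A (m + 1 - j)) i i

/-- The off-diagonal solution `X` of `X * D - D * X = R` for a diagonal matrix `D`. -/
noncomputable def commutatorSolution (D R : Matrix (Fin 2) (Fin 2) ℂ) :
    Matrix (Fin 2) (Fin 2) ℂ :=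
  !![0, R 0 1 / (D 1 1 - D 0 0); R 1 0 / (D 0 0 - D 1 1), 0]

/-- The off-diagonal coefficients `A`, as forced by the off-diagonal part of the recursion. -/
noncomputable def offDiagonalCoeff (W : ℕ → Matrix (Fin 2) (Fin 2) ℂ) (n : ℕ)
    (A : ℕ → Matrix (Fin 2) (Fin 2) ℂ) : Matrix (Fin 2) (Fin 2) ℂ :=
  if n = 0 then 1 else commutatorSolution (W 0) (recursionRHS W A (diagonalCoeff W A) n)

theorem commutator_eq_iff {D R X : Matrix (Fin 2) (Fin 2) ℂ}
    (hD : D 0 1 = 0 ∧ D 1 0 = 0) (hne : D 0 0 ≠ D 1 1) (hX : X 0 0 = 0 ∧ X 1 1 = 0) :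
    X * D - D * X = R ↔ X = commutatorSolution D R ∧ ∀ i, R i i = 0 := by
  have h₁ : D 1 1 - D 0 0 ≠ 0 := sub_ne_zero.mpr hne.symm
  have h₂ : D 0 0 - D 1 1 ≠ 0 := sub_ne_zero.mpr hne
  simp only [← Matrix.ext_iff, Fin.forall_fin_two, commutatorSolution, Matrix.sub_apply,
    Matrix.mul_apply, Fin.sum_univ_two, hD.1, hD.2, hX.1, hX.2, of_apply, cons_val', cons_val_zero,
    cons_val_one, cons_val_fin_one, eq_div_iff h₁, eq_div_iff h₂]
  constructor
  · rintro ⟨⟨h00, h01⟩, h10, h11⟩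
    refine ⟨⟨⟨trivial, ?_⟩, ?_, trivial⟩, ?_, ?_⟩
    · linear_combination h01
    · linear_combination h10
    · linear_combination -h00
    · linear_combination -h11
  · rintro ⟨⟨⟨-, h01⟩, h10, -⟩, h00, h11⟩
    refine ⟨⟨?_, ?_⟩, ?_, ?_⟩
    · linear_combination -h00
    · linear_combination h01
    · linear_combination h10
    · linear_combination -h11

theorem diagonalCoeff_congr (W : ℕ → Matrix (Fin 2) (Fin 2) ℂ)
    {A A' : ℕ → Matrix (Fin 2) (Fin 2) ℂ} {m : ℕ} (h : ∀ k ≤ m, A k = A' k) :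
    diagonalCoeff W A m = diagonalCoeff W A' m := by
  have hsum : ∑ j ∈ Icc 1 (m + 1), W j * A (m + 1 - j)
      = ∑ j ∈ Icc 1 (m + 1), W j * A' (m + 1 - j) :=
    sum_congr rfl fun j hj => by
      rw [mem_Icc] at hj
      rw [h _ (by omega)]
  simp only [diagonalCoeff, hsum]

theorem offDiagonalCoeff_congr (W : ℕ → Matrix (Fin 2) (Fin 2) ℂ) (n : ℕ)
    (A A' : ℕ → Matrix (Fin 2) (Fin 2) ℂ) (h : ∀ m < n, A m = A' m) :
    offDiagonalCoeff W n A = offDiagonalCoeff W n A' := by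
  rcases Nat.eq_zero_or_pos n with rfl | hn
  · simp [offDiagonalCoeff]
  have hB : ∑ j ∈ Icc 1 (n - 1), (j : ℂ) • (A (n - 1 - j) * diagonalCoeff W A j)
      = ∑ j ∈ Icc 1 (n - 1), (j : ℂ) • (A' (n - 1 - j) * diagonalCoeff W A' j) :=
    sum_congr rfl fun j hj => by
      rw [mem_Icc] at hj
      rw [h _ (by omega), diagonalCoeff_congr W fun k hk => h k (by omega)]
  have hW : ∑ j ∈ Icc 1 n, W j * A (n - j) = ∑ j ∈ Icc 1 n, W j * A' (n - j) :=
    sum_congr rfl fun j hj => by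
      rw [mem_Icc] at hj
      rw [h _ (by omega)]
  simp only [offDiagonalCoeff, recursionRHS, hB, hW, h (n - 1) (by omega)]

/-- An off-diagonal matrix times a diagonal one has zero diagonal. -/
theorem mul_apply_self_eq_zero {X D : Matrix (Fin 2) (Fin 2) ℂ} (hX : X 0 0 = 0 ∧ X 1 1 = 0)
    (hD : D 0 1 = 0 ∧ D 1 0 = 0) (i : Fin 2) : (X * D) i i = 0 := by
  fin_cases i <;> simp [Matrix.mul_apply, Fin.sum_univ_two, hX, hD]

theorem recursionRHS_one_apply_self {W A B : ℕ → Matrix (Fin 2) (Fin 2) ℂ} (hA0 : A 0 = 1)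
    (i : Fin 2) : recursionRHS W A B 1 i i = 0 := by
  simp [recursionRHS, hA0]

theorem recursionRHS_apply_self {W A B : ℕ → Matrix (Fin 2) (Fin 2) ℂ} (hA0 : A 0 = 1)
    (hA : ∀ n, 1 ≤ n → A n 0 0 = 0 ∧ A n 1 1 = 0) (hB : ∀ n, B n 0 1 = 0 ∧ B n 1 0 = 0)
    {m : ℕ} (hm : 1 ≤ m) (i : Fin 2) :
    recursionRHS W A B (m + 1) i i
      = m * B m i i + (∑ j ∈ Icc 1 (m + 1), W j * A (m + 1 - j)) i i := by
  have hAm : A m i i = 0 := by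
    fin_cases i
    exacts [(hA m hm).1, (hA m hm).2]
  have hsum : (∑ j ∈ Icc 1 m, (j : ℂ) • (A (m - j) * B j)) i i = m * B m i i := by
    rw [Matrix.sum_apply, sum_eq_single_of_mem m (mem_Icc.mpr ⟨hm, le_rfl⟩)]
    · simp [hA0]
    · intro j hj hjm
      rw [mem_Icc] at hj
      rw [Matrix.smul_apply, mul_apply_self_eq_zero (hA _ (by omega)) (hB j), smul_zero]
  have hdiag : (A m * diagonal fun i => W 1 i i) i i = 0 := by simp [hAm]
  simp only [recursionRHS, Nat.add_sub_cancel, Matrix.add_apply, Matrix.sub_apply,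
    Matrix.smul_apply, hAm, hdiag, hsum, smul_zero, sub_zero, zero_add]

/-- The diagonal part of the recursion is solved exactly by `diagonalCoeff`. -/
theorem recursionRHS_diag_eq_zero_iff {W A B : ℕ → Matrix (Fin 2) (Fin 2) ℂ} (hA0 : A 0 = 1)
    (hA : ∀ n, 1 ≤ n → A n 0 0 = 0 ∧ A n 1 1 = 0) (hB0 : B 0 = 0)
    (hB : ∀ n, B n 0 1 = 0 ∧ B n 1 0 = 0) :
    (∀ n, 1 ≤ n → ∀ i, recursionRHS W A B n i i = 0) ↔ B = diagonalCoeff W A := by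
  have key : ∀ m, 1 ≤ m → ∀ i, (recursionRHS W A B (m + 1) i i = 0 ↔
      B m i i = diagonalCoeff W A m i i) := by
    intro m hm i
    have hm0 : (m : ℂ) ≠ 0 := Nat.cast_ne_zero.mpr (by omega)
    rw [recursionRHS_apply_self hA0 hA hB hm, diagonalCoeff, diagonal_apply_eq,
      add_eq_zero_iff_eq_neg, neg_mul, ← mul_neg, eq_inv_mul_iff_mul_eq₀ hm0]
  constructor
  · intro h
    funext m
    rcases Nat.eq_zero_or_pos m with rfl | hm
    · simp [hB0, diagonalCoeff]
    · ext i j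
      by_cases hij : i = j
      · subst hij
        exact (key m hm i).mp (h _ (by omega) i)
      · rw [diagonalCoeff, diagonal_apply_ne _ hij]
        fin_cases i <;> fin_cases j <;> simp_all
  · rintro h (_ | _ | m) hn i
    · omega
    · exact recursionRHS_one_apply_self hA0 i
    · exact (key (m + 1) (by omega) i).mpr (by rw [h])

end QuasiclassicalRecursion

open QuasiclassicalRecursion

/-- Existence and uniqueness of the coefficients of the formal quasiclassical
solution: given matrices `W n` with `W 0` diagonal with distinct diagonal
entries, there are unique sequences `A`, `B` with `A 0 = 1`, `B 0 = 0`, `A n`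
off-diagonal for `n ≥ 1`, `B n` diagonal, satisfying for `n ≥ 1` the recursion
`Aₙ W₀ - W₀ Aₙ = (n-1) A_{n-1} - A_{n-1} W₁ᵈ + Σ_{j=1}^{n-1} j A_{n-1-j} B_j
+ Σ_{j=1}^{n} W_j A_{n-j}`, where `W₁ᵈ` is the diagonal part of `W 1`. -/
theorem formal_quasiclassical_solution_recursion
    (W : ℕ → Matrix (Fin 2) (Fin 2) ℂ)
    (hW0offdiag : W 0 0 1 = 0 ∧ W 0 1 0 = 0)
    (hW0distinct : W 0 0 0 ≠ W 0 1 1) :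
    ∃! AB : (ℕ → Matrix (Fin 2) (Fin 2) ℂ) × (ℕ → Matrix (Fin 2) (Fin 2) ℂ),
      AB.1 0 = 1 ∧
      AB.2 0 = 0 ∧
      (∀ n : ℕ, 1 ≤ n → AB.1 n 0 0 = 0 ∧ AB.1 n 1 1 = 0) ∧
      (∀ n : ℕ, AB.2 n 0 1 = 0 ∧ AB.2 n 1 0 = 0) ∧
      (∀ n : ℕ, 1 ≤ n →
        AB.1 n * W 0 - W 0 * AB.1 n
          = ((n : ℂ) - 1) • AB.1 (n - 1)
            - AB.1 (n - 1) * Matrix.diagonal (fun i => W 1 i i)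
            + (∑ j ∈ Finset.Icc 1 (n - 1), (j : ℂ) • (AB.1 (n - 1 - j) * AB.2 j))
            + ∑ j ∈ Finset.Icc 1 n, W j * AB.1 (n - j)) := by
  obtain ⟨A, hA, hAuniq⟩ :=
    existsUnique_of_causal (offDiagonalCoeff W) (offDiagonalCoeff_congr W)
  have hA0 : A 0 = 1 := by rw [hA 0, offDiagonalCoeff, if_pos rfl]
  have hAsol : ∀ n, 1 ≤ n →
      A n = commutatorSolution (W 0) (recursionRHS W A (diagonalCoeff W A) n) := fun n hn => by
    conv_lhs => rw [hA n, offDiagonalCoeff, if_neg (by omega)]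
  have hAoff : ∀ n, 1 ≤ n → A n 0 0 = 0 ∧ A n 1 1 = 0 := fun n hn => by
    rw [hAsol n hn]
    simp [commutatorSolution]
  have hB0 : diagonalCoeff W A 0 = 0 := by simp [diagonalCoeff]
  have hBdiag : ∀ n, diagonalCoeff W A n 0 1 = 0 ∧ diagonalCoeff W A n 1 0 = 0 := fun n => by
    simp [diagonalCoeff]
  refine ⟨(A, diagonalCoeff W A), ⟨hA0, hB0, hAoff, hBdiag, fun n hn => ?_⟩, ?_⟩
  · exact (commutator_eq_iff hW0offdiag hW0distinct (hAoff n hn)).mpr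
      ⟨hAsol n hn, (recursionRHS_diag_eq_zero_iff hA0 hAoff hB0 hBdiag).mpr rfl n hn⟩
  · rintro ⟨A', B'⟩ ⟨hA0', hB0', hAoff', hBdiag', hrec⟩
    dsimp only at hA0' hB0' hAoff' hBdiag' hrec
    have hsplit := fun n hn =>
      (commutator_eq_iff (R := recursionRHS W A' B' n) hW0offdiag hW0distinct (hAoff' n hn)).mp
        (hrec n hn)
    have hB' : B' = diagonalCoeff W A' :=
      (recursionRHS_diag_eq_zero_iff hA0' hAoff' hB0' hBdiag').mp fun n hn => (hsplit n hn).2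
    have hA' : A' = A := hAuniq A' fun n => by
      rcases Nat.eq_zero_or_pos n with rfl | hn
      · rw [hA0', offDiagonalCoeff, if_pos rfl]
      · rw [offDiagonalCoeff, if_neg (by omega), ← hB']
        exact (hsplit n hn).1
    rw [hB', hA']
end

section
/- Let q ∈ ℂ with Re q > 0 and let d₁, d₂, d₃, d₄ ≥ 0. Then there exists τ₀ > 0 (depending only on q and the dᵢ) such that: for every continuous V : [τ₀, ∞) → M₂(ℂ) with |V₁₁(τ)| ≤ d₁/τ², |V₁₂(τ)| ≤ d₂/τ, |V₂₁(τ)| ≤ d₃/τ, |V₂₂(τ)| ≤ d₄/τ² for all τ ≥ τ₀, there exists exactly one differentiable φ : [τ₀, ∞) → ℂ² satisfying φ'(τ) = (diag(q, −q) + V(τ))·φ(τ) for all τ ≥ τ₀ together with the asymptotic normalization e^{qτ}·φ(τ) → (0, 1) as τ → ∞. Moreover this solution satisfies |e^{qτ}φ₁(τ)| = O(1/τ) as τ → ∞. -/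
open Filter Set MeasureTheory

theorem norm_le_of_norm_deriv_le_neg_deriv {h h' : ℝ → ℂ} {G G' : ℝ → ℝ} {t : ℝ}
    (hh : ∀ s ∈ Ici t, HasDerivWithinAt h (h' s) (Ici t) s)
    (hG : ∀ s ∈ Ici t, HasDerivAt G (G' s) s)
    (bound : ∀ s ∈ Ici t, ‖h' s‖ ≤ -G' s)
    (h_lim : Tendsto h atTop (nhds 0)) (G_lim : Tendsto G atTop (nhds 0)) :
    ‖h t‖ ≤ G t := by
  have key : ∀ T ∈ Ici t, ‖h T - h t‖ ≤ G t - G T := by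
    intro T hT
    refine image_norm_le_of_norm_deriv_right_le_deriv_boundary' (f := fun s => h s - h t)
      (f' := h') (a := t) (b := T) (B := fun s => G t - G s) (B' := fun s => -G' s)
      ?_ ?_ (by simp) ?_ ?_ ?_ ⟨hT, le_rfl⟩
    · exact fun s hs => (((hh s hs.1).continuousWithinAt.mono Icc_subset_Ici_self).sub
        continuousWithinAt_const)
    · exact fun s hs => ((hh s hs.1).mono (Ici_subset_Ici.2 hs.1)).sub_const _
    · exact fun s hs => (continuousAt_const.sub (hG s hs.1).continuousAt).continuousWithinAt
    · exact fun s hs => ((hG s hs.1).const_sub _).hasDerivWithinAt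
    · exact fun s hs => bound s hs.1
  have h1 : Tendsto (fun T => ‖h T - h t‖) atTop (nhds ‖0 - h t‖) :=
    (h_lim.sub tendsto_const_nhds).norm
  have h2 : Tendsto (fun T => G t - G T) atTop (nhds (G t - 0)) :=
    tendsto_const_nhds.sub G_lim
  simpa using le_of_tendsto_of_tendsto h1 h2 ((eventually_ge_atTop t).mono key)

theorem norm_le_of_norm_deriv_le_exp {h h' : ℝ → ℂ} {b C t : ℝ} (hb : 0 < b)
    (hh : ∀ s ∈ Ici t, HasDerivWithinAt h (h' s) (Ici t) s)
    (bound : ∀ s ∈ Ici t, ‖h' s‖ ≤ C * Real.exp (-b * s))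
    (h_lim : Tendsto h atTop (nhds 0)) :
    ‖h t‖ ≤ C / b * Real.exp (-b * t) := by
  refine norm_le_of_norm_deriv_le_neg_deriv (G := fun s => C / b * Real.exp (-b * s))
    (G' := fun s => -(C * Real.exp (-b * s))) hh (fun s _ => ?_) (by simpa using bound) h_lim ?_
  · have := (((hasDerivAt_id s).const_mul (-b)).exp).const_mul (C / b)
    refine this.congr_deriv ?_
    simp only [id]
    field_simp
  · have h1 : Tendsto (fun s : ℝ => -b * s) atTop atBot :=
      tendsto_id.const_mul_atTop_of_neg (neg_lt_zero.2 hb)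
    simpa using (Real.tendsto_exp_atBot.comp h1).const_mul (C / b)

theorem norm_le_of_norm_deriv_le_inv_sq {h h' : ℝ → ℂ} {C t : ℝ} (ht : 0 < t)
    (hh : ∀ s ∈ Ici t, HasDerivWithinAt h (h' s) (Ici t) s)
    (bound : ∀ s ∈ Ici t, ‖h' s‖ ≤ C / s ^ 2)
    (h_lim : Tendsto h atTop (nhds 0)) :
    ‖h t‖ ≤ C / t := by
  refine norm_le_of_norm_deriv_le_neg_deriv (G := fun s => C / s)
    (G' := fun s => -(C / s ^ 2)) hh (fun s hs => ?_) (by simpa using bound) h_lim ?_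
  · have hs0 : s ≠ 0 := (ht.trans_le hs).ne'
    refine ((hasDerivAt_inv hs0).const_mul C).congr_deriv ?_
    field_simp
  · exact tendsto_const_nhds.div_atTop tendsto_id

/-- The primitive of `f` that vanishes at `+∞`, when `f` is integrable there. -/
noncomputable def tailPrimitive (t : ℝ) (f : ℝ → ℂ) (τ : ℝ) : ℂ :=
  (∫ s in t..τ, f s) - ∫ s in Ioi t, f s

theorem hasDerivAt_tailPrimitive (t : ℝ) {f : ℝ → ℂ} (hf : Continuous f) (τ : ℝ) :
    HasDerivAt (tailPrimitive t f) (f τ) τ :=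
  (intervalIntegral.integral_hasDerivAt_right (hf.intervalIntegrable _ _)
    (hf.stronglyMeasurableAtFilter _ _) hf.continuousAt).sub_const _

theorem tendsto_tailPrimitive {t : ℝ} {f : ℝ → ℂ} (hf : IntegrableOn f (Ioi t)) :
    Tendsto (tailPrimitive t f) atTop (nhds 0) := by
  unfold tailPrimitive
  simpa using
    (intervalIntegral_tendsto_integral_Ioi t hf tendsto_id).sub_const (∫ s in Ioi t, f s)

theorem integrableOn_Ioi_of_norm_le_exp {f : ℝ → ℂ} {b C t : ℝ} (hb : 0 < b)
    (hf : Continuous f) (bound : ∀ s ∈ Ici t, ‖f s‖ ≤ C * Real.exp (-b * s)) :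
    IntegrableOn f (Ioi t) :=
  ((exp_neg_integrableOn_Ioi t hb).const_mul C).mono' hf.aestronglyMeasurable
    ((ae_restrict_mem measurableSet_Ioi).mono fun s hs => bound s (Ioi_subset_Ici_self hs))

theorem integrableOn_Ioi_of_norm_le_inv_sq {f : ℝ → ℂ} {C t : ℝ} (ht : 0 < t)
    (hf : Continuous f) (bound : ∀ s ∈ Ici t, ‖f s‖ ≤ C / s ^ 2) :
    IntegrableOn f (Ioi t) := by
  refine (((integrableOn_Ioi_rpow_of_lt (a := -2) (by norm_num) ht)).const_mul C).mono'
    hf.aestronglyMeasurable ((ae_restrict_mem measurableSet_Ioi).mono fun s hs => ?_)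
  have hs0 : 0 < s := ht.trans hs
  refine (bound s (Ioi_subset_Ici_self hs)).trans (le_of_eq ?_)
  rw [Real.rpow_neg hs0.le, div_eq_mul_inv]
  norm_num

/-- The data of the perturbation bounds on `[τ₀, ∞)`, with a weight `K` for the first component
for which the associated integral operator contracts. -/
structure WeightedBounds (q : ℂ) (V : ℝ → Matrix (Fin 2) (Fin 2) ℂ) (d₁ d₂ d₃ d₄ K τ₀ : ℝ) :
    Prop where
  re_pos : 0 < q.re
  K_pos : 0 < K
  d₁_nonneg : 0 ≤ d₁
  d₂_nonneg : 0 ≤ d₂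
  d₃_nonneg : 0 ≤ d₃
  d₄_nonneg : 0 ≤ d₄
  τ₀_pos : 0 < τ₀
  first : d₁ * K / τ₀ ^ 2 + d₂ ≤ q.re * K
  second : 2 * (d₃ * K + d₄) ≤ τ₀
  bound : ∀ τ : ℝ, τ₀ ≤ τ →
    ‖V τ 0 0‖ ≤ d₁ / τ ^ 2 ∧ ‖V τ 0 1‖ ≤ d₂ / τ ∧ ‖V τ 1 0‖ ≤ d₃ / τ ∧ ‖V τ 1 1‖ ≤ d₄ / τ ^ 2

namespace WeightedBounds

variable {q : ℂ} {V : ℝ → Matrix (Fin 2) (Fin 2) ℂ} {d₁ d₂ d₃ d₄ K τ₀ : ℝ}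

theorem norm_first_row_le (B : WeightedBounds q V d₁ d₂ d₃ d₄ K τ₀) {s N : ℝ} (hs : τ₀ ≤ s)
    {x y : ℂ} (hx : ‖x‖ ≤ K * N / s) (hy : ‖y‖ ≤ N) :
    ‖V s 0 0 * x + V s 0 1 * y‖ ≤ q.re * K * N / s := by
  obtain ⟨h1, h2, -, -⟩ := B.bound s hs
  have hτ := B.τ₀_pos
  have hs0 : 0 < s := hτ.trans_le hs
  have hN : 0 ≤ N := (norm_nonneg _).trans hy
  have hd₁ := B.d₁_nonneg
  have hd₂ := B.d₂_nonneg
  have hK := B.K_pos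
  calc ‖V s 0 0 * x + V s 0 1 * y‖ ≤ ‖V s 0 0‖ * ‖x‖ + ‖V s 0 1‖ * ‖y‖ := by
        simpa only [norm_mul] using norm_add_le (V s 0 0 * x) (V s 0 1 * y)
    _ ≤ d₁ / s ^ 2 * (K * N / s) + d₂ / s * N := by gcongr
    _ = (d₁ * K / s ^ 2 + d₂) * (N / s) := by ring
    _ ≤ (d₁ * K / τ₀ ^ 2 + d₂) * (N / s) := by gcongr
    _ ≤ q.re * K * (N / s) := by gcongr; exact B.first
    _ = q.re * K * N / s := by ring

theorem norm_second_row_le (B : WeightedBounds q V d₁ d₂ d₃ d₄ K τ₀) {s N : ℝ} (hs : τ₀ ≤ s)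
    {x y : ℂ} (hx : ‖x‖ ≤ K * N / s) (hy : ‖y‖ ≤ N) :
    ‖V s 1 0 * x + V s 1 1 * y‖ ≤ τ₀ / 2 * N / s ^ 2 := by
  obtain ⟨-, -, h3, h4⟩ := B.bound s hs
  have hs0 : 0 < s := B.τ₀_pos.trans_le hs
  have hN : 0 ≤ N := (norm_nonneg _).trans hy
  have hd₃ := B.d₃_nonneg
  have hd₄ := B.d₄_nonneg
  calc ‖V s 1 0 * x + V s 1 1 * y‖ ≤ ‖V s 1 0‖ * ‖x‖ + ‖V s 1 1‖ * ‖y‖ := by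
        simpa only [norm_mul] using norm_add_le (V s 1 0 * x) (V s 1 1 * y)
    _ ≤ d₃ / s * (K * N / s) + d₄ / s ^ 2 * N := by gcongr
    _ = (d₃ * K + d₄) * (N / s ^ 2) := by ring
    _ ≤ τ₀ / 2 * (N / s ^ 2) := by gcongr; linarith [B.second]
    _ = τ₀ / 2 * N / s ^ 2 := by ring

theorem norm_exp_mul_first_row_le (B : WeightedBounds q V d₁ d₂ d₃ d₄ K τ₀) {s t N : ℝ}
    (ht : τ₀ ≤ t) (hs : t ≤ s) {x y : ℂ} (hx : ‖x‖ ≤ K * N / s) (hy : ‖y‖ ≤ N) :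
    ‖Complex.exp (-(2 * q) * s) * (V s 0 0 * x + V s 0 1 * y)‖ ≤
      q.re * K * N / t * Real.exp (-(2 * q.re) * s) := by
  have ht0 : 0 < t := B.τ₀_pos.trans_le ht
  have hN : 0 ≤ N := (norm_nonneg _).trans hy
  have hK := B.K_pos
  have hq := B.re_pos
  have he : ‖Complex.exp (-(2 * q) * s)‖ = Real.exp (-(2 * q.re) * s) := by
    rw [Complex.norm_exp]; simp
  rw [norm_mul, he, mul_comm]
  gcongr
  exact (B.norm_first_row_le (ht.trans hs) hx hy).trans (by gcongr)

/-- One step of the weighted estimate: the decaying primitives of the two rows satisfy the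
weighted bound with half the constant. -/
theorem norm_primitive_le (B : WeightedBounds q V d₁ d₂ d₃ d₄ K τ₀) {N : ℝ}
    {u₁ u₂ h₁ h₂ : ℝ → ℂ}
    (hu₁ : ∀ s ∈ Ici τ₀, ‖u₁ s‖ ≤ K * N / s) (hu₂ : ∀ s ∈ Ici τ₀, ‖u₂ s‖ ≤ N)
    (hh₁ : ∀ s ∈ Ici τ₀, HasDerivWithinAt h₁
      (Complex.exp (-(2 * q) * s) * (V s 0 0 * u₁ s + V s 0 1 * u₂ s)) (Ici τ₀) s)
    (hh₂ : ∀ s ∈ Ici τ₀, HasDerivWithinAt h₂ (V s 1 0 * u₁ s + V s 1 1 * u₂ s) (Ici τ₀) s)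
    (lim₁ : Tendsto h₁ atTop (nhds 0)) (lim₂ : Tendsto h₂ atTop (nhds 0))
    {t : ℝ} (ht : t ∈ Ici τ₀) :
    ‖Complex.exp (2 * q * t) * h₁ t‖ ≤ K * (N / 2) / t ∧ ‖h₂ t‖ ≤ N / 2 := by
  have ht0 : 0 < t := B.τ₀_pos.trans_le ht
  have hN : 0 ≤ N := (norm_nonneg _).trans (hu₂ t ht)
  have hq := B.re_pos
  have hsub : Ici t ⊆ Ici τ₀ := Ici_subset_Ici.2 ht
  constructor
  · have h := norm_le_of_norm_deriv_le_exp (b := 2 * q.re) (by linarith)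
      (fun s hs => (hh₁ s (hsub hs)).mono hsub)
      (fun s hs => B.norm_exp_mul_first_row_le ht hs (hu₁ s (hsub hs)) (hu₂ s (hsub hs))) lim₁
    have he : ‖Complex.exp (2 * q * t)‖ = Real.exp (2 * q.re * t) := by
      rw [Complex.norm_exp]; simp
    rw [norm_mul, he]
    calc Real.exp (2 * q.re * t) * ‖h₁ t‖
        ≤ Real.exp (2 * q.re * t) *
          (q.re * K * N / t / (2 * q.re) * Real.exp (-(2 * q.re) * t)) := by gcongr
      _ = K * (N / 2) / t * (Real.exp (2 * q.re * t) * Real.exp (-(2 * q.re) * t)) := by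
          field_simp
      _ = K * (N / 2) / t := by rw [← Real.exp_add]; simp
  · have h := norm_le_of_norm_deriv_le_inv_sq ht0
      (fun s hs => (hh₂ s (hsub hs)).mono hsub)
      (fun s hs => B.norm_second_row_le (hsub hs) (hu₁ s (hsub hs)) (hu₂ s (hsub hs))) lim₂
    refine h.trans ?_
    rw [div_le_iff₀ ht0]
    have : τ₀ ≤ t := ht
    nlinarith

/-- A solution of the homogeneous integrated system that tends to zero vanishes. -/
theorem eq_zero_of_tendsto_zero (B : WeightedBounds q V d₁ d₂ d₃ d₄ K τ₀) {u₁ u₂ h₁ : ℝ → ℂ}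
    (hu : ∀ s, u₁ s = Complex.exp (2 * q * s) * h₁ s)
    (hh₁ : ∀ s ∈ Ici τ₀, HasDerivWithinAt h₁
      (Complex.exp (-(2 * q) * s) * (V s 0 0 * u₁ s + V s 0 1 * u₂ s)) (Ici τ₀) s)
    (hh₂ : ∀ s ∈ Ici τ₀, HasDerivWithinAt u₂ (V s 1 0 * u₁ s + V s 1 1 * u₂ s) (Ici τ₀) s)
    (lim₁ : Tendsto u₁ atTop (nhds 0)) (lim₂ : Tendsto u₂ atTop (nhds 0))
    {t : ℝ} (ht : t ∈ Ici τ₀) : u₁ t = 0 ∧ u₂ t = 0 := by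
  have hq := B.re_pos
  have hK := B.K_pos
  have hτ := B.τ₀_pos
  have hd₁ := B.d₁_nonneg
  have hd₂ := B.d₂_nonneg
  have limh : Tendsto h₁ atTop (nhds 0) := by
    have he : Tendsto (fun s : ℝ => Complex.exp (-(2 * q) * s)) atTop (nhds 0) := by
      rw [Complex.tendsto_exp_nhds_zero_iff]
      have : Tendsto (fun s : ℝ => -(2 * q.re) * s) atTop atBot :=
        tendsto_id.const_mul_atTop_of_neg (by linarith)
      simpa using this
    have := he.mul lim₁
    rw [zero_mul] at this
    refine this.congr fun s => ?_
    rw [hu, ← mul_assoc, ← Complex.exp_add]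
    simp
  have hc₁ : ContinuousOn u₁ (Ici τ₀) := by
    have : ContinuousOn (fun s : ℝ => Complex.exp (2 * q * s) * h₁ s) (Ici τ₀) :=
      (by fun_prop : Continuous fun s : ℝ => Complex.exp (2 * q * s)).continuousOn.mul
        fun s hs => (hh₁ s hs).continuousWithinAt
    exact this.congr fun s _ => hu s
  have hc₂ : ContinuousOn u₂ (Ici τ₀) := fun s hs => (hh₂ s hs).continuousWithinAt
  have bdd : ∀ u : ℝ → ℂ, ContinuousOn u (Ici τ₀) → Tendsto u atTop (nhds 0) →
      ∃ M, 0 ≤ M ∧ ∀ s ∈ Ici τ₀, ‖u s‖ ≤ M := by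
    intro u hc hl
    obtain ⟨T, hT⟩ := eventually_atTop.1 (hl.norm.eventually_le_const
      (by simp : ‖(0 : ℂ)‖ < 1))
    obtain ⟨M, hM⟩ := (isCompact_Icc (a := τ₀) (b := T)).exists_bound_of_continuousOn
      (hc.mono Icc_subset_Ici_self)
    refine ⟨max M 1, le_max_of_le_right zero_le_one, fun s hs => ?_⟩
    rcases le_total s T with h | h
    · exact (hM s ⟨hs, h⟩).trans (le_max_left _ _)
    · exact (hT s h).trans (le_max_right _ _)
  obtain ⟨M₁, hM₁0, hM₁⟩ := bdd u₁ hc₁ lim₁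
  obtain ⟨M₂, hM₂0, hM₂⟩ := bdd u₂ hc₂ lim₂
  -- The crude bound gives decay of `u₁`, which starts the iteration.
  have crude : ∀ s ∈ Ici τ₀, ‖u₁ s‖ ≤ (d₁ / τ₀ * M₁ + d₂ * M₂) / (2 * q.re) / s := by
    intro s hs
    have hs0 : 0 < s := hτ.trans_le hs
    have hsub : Ici s ⊆ Ici τ₀ := Ici_subset_Ici.2 hs
    have h := norm_le_of_norm_deriv_le_exp (b := 2 * q.re)
      (C := (d₁ / τ₀ * M₁ + d₂ * M₂) / s) (by linarith)
      (fun r hr => (hh₁ r (hsub hr)).mono hsub) (fun r hr => by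
        obtain ⟨b1, b2, -, -⟩ := B.bound r (hsub hr)
        have hsr : s ≤ r := hr
        have hr0 : 0 < r := hs0.trans_le hsr
        have hτr : τ₀ ≤ r := hsub hr
        have he : ‖Complex.exp (-(2 * q) * r)‖ = Real.exp (-(2 * q.re) * r) := by
          rw [Complex.norm_exp]; simp
        rw [norm_mul, he, mul_comm]
        gcongr
        calc ‖V r 0 0 * u₁ r + V r 0 1 * u₂ r‖
            ≤ ‖V r 0 0‖ * ‖u₁ r‖ + ‖V r 0 1‖ * ‖u₂ r‖ := by
              simpa only [norm_mul] using norm_add_le (V r 0 0 * u₁ r) (V r 0 1 * u₂ r)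
          _ ≤ d₁ / r ^ 2 * M₁ + d₂ / r * M₂ := by
              have := hM₁ r (hsub hr)
              have := hM₂ r (hsub hr)
              gcongr
          _ = (d₁ / r * M₁ + d₂ * M₂) / r := by field_simp
          _ ≤ (d₁ / τ₀ * M₁ + d₂ * M₂) / s := by gcongr) limh
    have he : ‖Complex.exp (2 * q * s)‖ = Real.exp (2 * q.re * s) := by
      rw [Complex.norm_exp]; simp
    rw [hu, norm_mul, he]
    calc Real.exp (2 * q.re * s) * ‖h₁ s‖
        ≤ Real.exp (2 * q.re * s) * ((d₁ / τ₀ * M₁ + d₂ * M₂) / s / (2 * q.re) *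
          Real.exp (-(2 * q.re) * s)) := by gcongr
      _ = (d₁ / τ₀ * M₁ + d₂ * M₂) / (2 * q.re) / s *
          (Real.exp (2 * q.re * s) * Real.exp (-(2 * q.re) * s)) := by ring
      _ = (d₁ / τ₀ * M₁ + d₂ * M₂) / (2 * q.re) / s := by rw [← Real.exp_add]; simp
  set C := (d₁ / τ₀ * M₁ + d₂ * M₂) / (2 * q.re) with hC
  have hC0 : 0 ≤ C := by positivity
  have iter : ∀ n : ℕ, ∀ s ∈ Ici τ₀, ‖u₁ s‖ ≤ K * ((C / K + M₂) * (1 / 2) ^ n) / s ∧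
      ‖u₂ s‖ ≤ (C / K + M₂) * (1 / 2) ^ n := by
    intro n
    induction n with
    | zero =>
      intro s hs
      have hs0 : 0 < s := hτ.trans_le hs
      refine ⟨(crude s hs).trans ?_, (hM₂ s hs).trans ?_⟩
      · gcongr
        have : K * ((C / K + M₂) * (1 / 2) ^ 0) = C + K * M₂ := by field_simp
        rw [this]
        nlinarith
      · have : 0 ≤ C / K := by positivity
        simpa using this
    | succ n ih =>
      intro s hs
      have := B.norm_primitive_le (fun r hr => (ih r hr).1) (fun r hr => (ih r hr).2) hh₁ hh₂
        limh lim₂ hs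
      rw [hu, pow_succ, mul_one_div, mul_div_assoc']
      exact this
  have hp : Tendsto (fun n : ℕ => (C / K + M₂) * (1 / 2 : ℝ) ^ n) atTop (nhds 0) := by
    simpa using (tendsto_pow_atTop_nhds_zero_of_lt_one (r := (1 / 2 : ℝ)) (by norm_num)
      (by norm_num)).const_mul (C / K + M₂)
  constructor
  · refine norm_le_zero_iff.1 (ge_of_tendsto' (x := atTop) ?_ fun n => (iter n t ht).1)
    simpa using (hp.const_mul K).div_const t
  · exact norm_le_zero_iff.1 (ge_of_tendsto' hp fun n => (iter n t ht).2)

/-- Existence of the solution of the integrated system normalized at `+∞`. -/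
theorem exists_primitive_system (B : WeightedBounds q V d₁ d₂ d₃ d₄ K τ₀) (hV : Continuous V) :
    ∃ (N : ℝ) (u₁ u₂ h₁ : ℝ → ℂ), (∀ s ∈ Ici τ₀, u₁ s = Complex.exp (2 * q * s) * h₁ s) ∧
      (∀ s ∈ Ici τ₀, HasDerivAt h₁
        (Complex.exp (-(2 * q) * s) * (V s 0 0 * u₁ s + V s 0 1 * u₂ s)) s) ∧
      (∀ s ∈ Ici τ₀, HasDerivWithinAt u₂ (V s 1 0 * u₁ s + V s 1 1 * u₂ s) (Ici τ₀) s) ∧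
      (∀ s ∈ Ici τ₀, ‖u₁ s‖ ≤ N / s) ∧ Tendsto u₂ atTop (nhds 1) := by
  have hq := B.re_pos
  have hK := B.K_pos
  have hτ := B.τ₀_pos
  have hm0 : ∀ s : ℝ, 0 < max s τ₀ := fun s => hτ.trans_le (le_max_right _ _)
  let U : BoundedContinuousFunction ℝ (ℂ × ℂ) → ℝ → ℂ := fun w s =>
    ((K / max s τ₀ : ℝ) : ℂ) * (w s).1
  have hUc : ∀ w, Continuous (U w) := fun w => by
    have : Continuous fun s : ℝ => K / max s τ₀ :=
      continuous_const.div (by fun_prop) fun s => (hm0 s).ne'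
    exact (Complex.continuous_ofReal.comp this).mul (continuous_fst.comp w.continuous)
  have norm_weight : ∀ s ∈ Ici τ₀, ∀ (z : ℂ) (N : ℝ), ‖z‖ ≤ N →
      ‖((K / max s τ₀ : ℝ) : ℂ) * z‖ ≤ K * N / s := by
    intro s hs z N hz
    have hs0 : 0 < s := hτ.trans_le hs
    rw [max_eq_left hs, norm_mul, Complex.norm_real, Real.norm_of_nonneg (by positivity),
      div_mul_eq_mul_div]
    gcongr
  have hU : ∀ w, ∀ s ∈ Ici τ₀, ‖U w s‖ ≤ K * ‖w‖ / s := fun w s hs =>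
    norm_weight s hs _ _ ((norm_fst_le _).trans (w.norm_coe_le_norm s))
  have hw₂ : ∀ w : BoundedContinuousFunction ℝ (ℂ × ℂ), ∀ s ∈ Ici τ₀, ‖(w s).2‖ ≤ ‖w‖ :=
    fun w s _ => (norm_snd_le _).trans (w.norm_coe_le_norm s)
  have hVc : ∀ i j, Continuous fun s => V s i j := fun i j => hV.matrix_elem i j
  have ex₁ : ∀ w : BoundedContinuousFunction ℝ (ℂ × ℂ), ∃ h : ℝ → ℂ, (∀ s : ℝ, HasDerivAt h
      (Complex.exp (-(2 * q) * s) * (V s 0 0 * U w s + V s 0 1 * (w s).2)) s) ∧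
      Tendsto h atTop (nhds 0) := fun w => by
    have hc : Continuous fun s : ℝ =>
        Complex.exp (-(2 * q) * s) * (V s 0 0 * U w s + V s 0 1 * (w s).2) :=
      (by fun_prop : Continuous fun s : ℝ => Complex.exp (-(2 * q) * s)).mul
        (((hVc 0 0).mul (hUc w)).add ((hVc 0 1).mul (continuous_snd.comp w.continuous)))
    exact ⟨_, hasDerivAt_tailPrimitive τ₀ hc, tendsto_tailPrimitive
      (integrableOn_Ioi_of_norm_le_exp (b := 2 * q.re) (by linarith) hc fun s hs =>
        B.norm_exp_mul_first_row_le le_rfl hs (hU w s hs) (hw₂ w s hs))⟩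
  have ex₂ : ∀ w : BoundedContinuousFunction ℝ (ℂ × ℂ), ∃ h : ℝ → ℂ, (∀ s : ℝ, HasDerivAt h
      (V s 1 0 * U w s + V s 1 1 * (w s).2) s) ∧ Tendsto h atTop (nhds 0) := fun w => by
    have hc : Continuous fun s : ℝ => V s 1 0 * U w s + V s 1 1 * (w s).2 :=
      ((hVc 1 0).mul (hUc w)).add ((hVc 1 1).mul (continuous_snd.comp w.continuous))
    exact ⟨_, hasDerivAt_tailPrimitive τ₀ hc, tendsto_tailPrimitive
      (integrableOn_Ioi_of_norm_le_inv_sq hτ hc fun s hs =>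
        B.norm_second_row_le hs (hU w s hs) (hw₂ w s hs))⟩
  choose H₁ dH₁ lH₁ using ex₁
  choose H₂ dH₂ lH₂ using ex₂
  have unweight : ∀ m ∈ Ici τ₀, ∀ (z : ℂ) (N : ℝ), ‖z‖ ≤ K * N / m →
      ‖((m / K : ℝ) : ℂ) * z‖ ≤ N := by
    intro m hm z N hz
    have hm0 : 0 < m := hτ.trans_le hm
    rw [norm_mul, Complex.norm_real, Real.norm_of_nonneg (by positivity)]
    calc m / K * ‖z‖ ≤ m / K * (K * N / m) := by gcongr
      _ = N := by field_simp
  let F : BoundedContinuousFunction ℝ (ℂ × ℂ) → ℝ → ℂ × ℂ := fun w m =>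
    (((m / K : ℝ) : ℂ) * (Complex.exp (2 * q * m) * H₁ w m), 1 + H₂ w m)
  have hFc : ∀ w, Continuous (F w) := fun w => by
    have c₁ : Continuous (H₁ w) := continuous_iff_continuousAt.2 fun s => (dH₁ w s).continuousAt
    have c₂ : Continuous (H₂ w) := continuous_iff_continuousAt.2 fun s => (dH₂ w s).continuousAt
    fun_prop
  have hF : ∀ w, ∀ m ∈ Ici τ₀, ‖F w m‖ ≤ 1 + ‖w‖ / 2 := fun w m hm => by
    obtain ⟨b₁, b₂⟩ := B.norm_primitive_le (hU w) (hw₂ w)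
      (fun s _ => (dH₁ w s).hasDerivWithinAt) (fun s _ => (dH₂ w s).hasDerivWithinAt)
      (lH₁ w) (lH₂ w) hm
    refine max_le ((unweight m hm _ _ b₁).trans (by linarith)) ((norm_add_le _ _).trans ?_)
    simpa using b₂
  have hFsub : ∀ w v, ∀ m ∈ Ici τ₀, ‖F w m - F v m‖ ≤ ‖w - v‖ / 2 := fun w v m hm => by
    obtain ⟨b₁, b₂⟩ := B.norm_primitive_le (hU (w - v)) (hw₂ (w - v))
      (h₁ := fun s => H₁ w s - H₁ v s) (h₂ := fun s => H₂ w s - H₂ v s)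
      (fun s _ => (((dH₁ w s).sub (dH₁ v s)).congr_deriv
        (by simp [U]; ring)).hasDerivWithinAt)
      (fun s _ => (((dH₂ w s).sub (dH₂ v s)).congr_deriv
        (by simp [U]; ring)).hasDerivWithinAt)
      (by simpa using (lH₁ w).sub (lH₁ v)) (by simpa using (lH₂ w).sub (lH₂ v)) hm
    refine max_le ?_ ?_
    · simpa [F, mul_sub] using unweight m hm _ _ b₁
    · simpa [F] using b₂
  let T : BoundedContinuousFunction ℝ (ℂ × ℂ) → BoundedContinuousFunction ℝ (ℂ × ℂ) := fun w =>
    BoundedContinuousFunction.ofNormedAddCommGroup (fun τ => F w (max τ τ₀))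
      ((hFc w).comp (by fun_prop)) (1 + ‖w‖ / 2) fun τ => hF w _ (mem_Ici.2 (le_max_right _ _))
  have hT : ContractingWith (1 / 2) T := by
    refine ⟨by rw [← NNReal.coe_lt_coe]; norm_num, LipschitzWith.of_dist_le_mul fun w v => ?_⟩
    rw [dist_eq_norm, dist_eq_norm]
    refine (BoundedContinuousFunction.norm_le (by positivity)).2 fun τ => ?_
    refine (hFsub w v _ (le_max_right τ τ₀)).trans (le_of_eq ?_)
    simp; ring
  obtain ⟨w, hw⟩ : ∃ w, T w = w := ⟨_, hT.fixedPoint_isFixedPt⟩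
  have hw' : ∀ s ∈ Ici τ₀, w s = F w s := fun s hs => by
    have h : T w s = F w (max s τ₀) := rfl
    rw [max_eq_left hs, hw] at h
    exact h
  have hw₂' : ∀ s ∈ Ici τ₀, (w s).2 = 1 + H₂ w s := fun s hs => by rw [hw' s hs]
  refine ⟨K * ‖w‖, U w, fun s => (w s).2, H₁ w, fun s hs => ?_, fun s _ => dH₁ w s,
    fun s hs => ?_, hU w, ?_⟩
  · have hs0 : s ≠ 0 := (hτ.trans_le hs).ne'
    have hsC : (s : ℂ) ≠ 0 := by exact_mod_cast hs0
    have hKC : (K : ℂ) ≠ 0 := by exact_mod_cast hK.ne'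
    simp only [U, hw' s hs, F, max_eq_left (mem_Ici.1 hs)]
    push_cast
    field_simp
  · exact ((dH₂ w s).const_add 1).hasDerivWithinAt.congr hw₂' (hw₂' s hs)
  · have h : Tendsto (fun s => 1 + H₂ w s) atTop (nhds 1) := by
      simpa using (lH₂ w).const_add 1
    exact h.congr' ((eventually_ge_atTop τ₀).mono fun s hs => (hw₂' s hs).symm)

end WeightedBounds

/-- In each component, the system `φ' = (diag(q, -q) + V) φ`. -/
theorem hasDerivWithinAt_system_iff {q : ℂ} {M : Matrix (Fin 2) (Fin 2) ℂ} {φ : ℝ → Fin 2 → ℂ}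
    {S : Set ℝ} {τ : ℝ} :
    HasDerivWithinAt φ ((Matrix.diagonal ![q, -q] + M).mulVec (φ τ)) S τ ↔
      HasDerivWithinAt (fun s => φ s 0) (q * φ τ 0 + (M 0 0 * φ τ 0 + M 0 1 * φ τ 1)) S τ ∧
      HasDerivWithinAt (fun s => φ s 1) (-q * φ τ 1 + (M 1 0 * φ τ 0 + M 1 1 * φ τ 1)) S τ := by
  rw [hasDerivWithinAt_pi, Fin.forall_fin_two]
  simp only [Matrix.mulVec, dotProduct, Fin.sum_univ_two, Matrix.add_apply]
  simp only [Matrix.diagonal_apply]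
  have e₁ : q * φ τ 0 + (M 0 0 * φ τ 0 + M 0 1 * φ τ 1) =
      (q + M 0 0) * φ τ 0 + M 0 1 * φ τ 1 := by ring
  have e₂ : -q * φ τ 1 + (M 1 0 * φ τ 0 + M 1 1 * φ τ 1) =
      M 1 0 * φ τ 0 + (-q + M 1 1) * φ τ 1 := by ring
  rw [e₁, e₂]
  simp

theorem hasDerivAt_cexp_const_mul (c : ℂ) (s : ℝ) :
    HasDerivAt (fun t : ℝ => Complex.exp (c * t)) (c * Complex.exp (c * s)) s := by
  have h : HasDerivAt (fun t : ℝ => c * (t : ℂ)) (c * 1) s :=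
    (Complex.ofRealCLM.hasDerivAt (x := s)).const_mul c
  exact h.cexp.congr_deriv (by ring)

theorem WeightedBounds.existence {q : ℂ} {V : ℝ → Matrix (Fin 2) (Fin 2) ℂ}
    {d₁ d₂ d₃ d₄ K τ₀ : ℝ} (B : WeightedBounds q V d₁ d₂ d₃ d₄ K τ₀)
    (hV : ContinuousOn V (Ici τ₀)) :
    ∃ φ : ℝ → Fin 2 → ℂ,
      (∀ τ ∈ Ici τ₀, HasDerivWithinAt φ ((Matrix.diagonal ![q, -q] + V τ).mulVec (φ τ))
        (Ici τ₀) τ) ∧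
      Tendsto (fun τ : ℝ => Complex.exp (q * τ) • φ τ) atTop (nhds ![0, 1]) ∧
      (fun τ : ℝ => Complex.exp (q * τ) * φ τ 0) =O[atTop] (fun τ : ℝ => 1 / τ) := by
  have hext : ∀ s ∈ Ici τ₀, V (max s τ₀) = V s := fun s hs => by rw [max_eq_left hs]
  have B' : WeightedBounds q (fun s => V (max s τ₀)) d₁ d₂ d₃ d₄ K τ₀ :=
    { B with bound := fun s hs => by simpa only [hext s hs] using B.bound s hs }
  obtain ⟨N, u₁, u₂, h₁, hu, dh, du, hN, hlim⟩ := B'.exists_primitive_system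
    (hV.comp_continuous (by fun_prop) fun s => mem_Ici.2 (le_max_right _ _))
  have hexp : ∀ a b : ℂ, ∀ s : ℝ, Complex.exp (a * s) * Complex.exp (b * s) =
      Complex.exp ((a + b) * s) := fun a b s => by rw [← Complex.exp_add, add_mul]
  have first : ∀ s ∈ Ici τ₀, Complex.exp (q * s) * (Complex.exp (q * s) * h₁ s) = u₁ s :=
    fun s hs => by rw [hu s hs, ← mul_assoc, hexp, two_mul]
  have second : ∀ s : ℝ, Complex.exp (q * s) * (Complex.exp (-q * s) * u₂ s) = u₂ s :=
    fun s => by rw [← mul_assoc, hexp]; simp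
  have hO : (fun τ : ℝ => Complex.exp (q * τ) * (Complex.exp (q * τ) * h₁ τ)) =O[atTop]
      (fun τ : ℝ => 1 / τ) := by
    refine Asymptotics.IsBigO.of_bound N ((eventually_ge_atTop τ₀).mono fun s hs => ?_)
    have hs0 : 0 < s := B.τ₀_pos.trans_le hs
    rw [first s hs, Real.norm_of_nonneg (by positivity), mul_one_div]
    exact hN s hs
  refine ⟨fun s => ![Complex.exp (q * s) * h₁ s, Complex.exp (-q * s) * u₂ s], ?_, ?_, ?_⟩
  · intro s hs
    rw [hasDerivWithinAt_system_iff]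
    have d₁ := dh s hs
    have d₂ := du s hs
    simp only [hext s hs] at d₁ d₂
    have e : Complex.exp (q * s) * Complex.exp (-(2 * q) * s) = Complex.exp (-q * s) := by
      rw [hexp]; ring_nf
    have e' : Complex.exp (-q * s) * u₁ s = Complex.exp (q * s) * h₁ s := by
      rw [hu s hs, ← mul_assoc, hexp]; ring_nf
    constructor
    · refine ((hasDerivAt_cexp_const_mul q s).mul d₁).hasDerivWithinAt.congr_deriv ?_
      simp only [Matrix.cons_val_zero, Matrix.cons_val_one]
      rw [← e', ← mul_assoc (Complex.exp (q * s)), e, mul_assoc q, ← e']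
      ring
    · refine ((hasDerivAt_cexp_const_mul (-q) s).hasDerivWithinAt.mul d₂).congr_deriv ?_
      simp only [Matrix.cons_val_zero, Matrix.cons_val_one]
      rw [← e']
      ring
  · rw [tendsto_pi_nhds, Fin.forall_fin_two]
    constructor
    · simpa using hO.trans_tendsto (by simpa using tendsto_inv_atTop_zero (𝕜 := ℝ))
    · simp only [Pi.smul_apply, smul_eq_mul, Matrix.cons_val_one, Matrix.cons_val_fin_one, second]
      exact hlim
  · simpa using hO

theorem WeightedBounds.uniqueness {q : ℂ} {V : ℝ → Matrix (Fin 2) (Fin 2) ℂ}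
    {d₁ d₂ d₃ d₄ K τ₀ : ℝ} (B : WeightedBounds q V d₁ d₂ d₃ d₄ K τ₀) {φ ψ : ℝ → Fin 2 → ℂ}
    {ℓ : Fin 2 → ℂ}
    (hφ : ∀ τ ∈ Ici τ₀, HasDerivWithinAt φ
      ((Matrix.diagonal ![q, -q] + V τ).mulVec (φ τ)) (Ici τ₀) τ)
    (lφ : Tendsto (fun τ : ℝ => Complex.exp (q * τ) • φ τ) atTop (nhds ℓ))
    (hψ : ∀ τ ∈ Ici τ₀, HasDerivWithinAt ψ
      ((Matrix.diagonal ![q, -q] + V τ).mulVec (ψ τ)) (Ici τ₀) τ)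
    (lψ : Tendsto (fun τ : ℝ => Complex.exp (q * τ) • ψ τ) atTop (nhds ℓ)) :
    EqOn φ ψ (Ici τ₀) := by
  intro t ht
  have hexp : ∀ a b : ℂ, ∀ s : ℝ, Complex.exp (a * s) * Complex.exp (b * s) =
      Complex.exp ((a + b) * s) := fun a b s => by rw [← Complex.exp_add, add_mul]
  have lim : ∀ i, Tendsto (fun τ : ℝ => Complex.exp (q * τ) * (φ τ i - ψ τ i)) atTop
      (nhds 0) := fun i => by
    simpa [mul_sub] using (tendsto_pi_nhds.1 lφ i).sub (tendsto_pi_nhds.1 lψ i)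
  obtain ⟨z₁, z₂⟩ := B.eq_zero_of_tendsto_zero
    (u₁ := fun s => Complex.exp (q * s) * (φ s 0 - ψ s 0))
    (u₂ := fun s => Complex.exp (q * s) * (φ s 1 - ψ s 1))
    (h₁ := fun s => Complex.exp (-q * s) * (φ s 0 - ψ s 0))
    (fun s => by
      rw [← mul_assoc, hexp]
      ring_nf)
    (fun s hs => by
      have e : Complex.exp (-q * s) = Complex.exp (-(2 * q) * s) * Complex.exp (q * s) := by
        rw [hexp]; ring_nf
      refine ((hasDerivAt_cexp_const_mul (-q) s).hasDerivWithinAt.mul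
        ((hasDerivWithinAt_system_iff.1 (hφ s hs)).1.sub
          (hasDerivWithinAt_system_iff.1 (hψ s hs)).1)).congr_deriv ?_
      rw [e, Pi.sub_apply]
      ring)
    (fun s hs => by
      refine ((hasDerivAt_cexp_const_mul q s).hasDerivWithinAt.mul
        ((hasDerivWithinAt_system_iff.1 (hφ s hs)).2.sub
          (hasDerivWithinAt_system_iff.1 (hψ s hs)).2)).congr_deriv ?_
      rw [Pi.sub_apply]
      ring)
    (lim 0) (lim 1) ht
  have cancel : ∀ z : ℂ, Complex.exp (q * t) * z = 0 → z = 0 := fun z hz =>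
    (mul_eq_zero.1 hz).resolve_left (Complex.exp_ne_zero _)
  funext i
  fin_cases i
  · exact sub_eq_zero.1 (cancel _ z₁)
  · exact sub_eq_zero.1 (cancel _ z₂)

theorem exists_weight_and_start {a d₁ d₂ d₃ d₄ : ℝ} (ha : 0 < a)
    (hd₁ : 0 ≤ d₁) (hd₂ : 0 ≤ d₂) (hd₃ : 0 ≤ d₃) (hd₄ : 0 ≤ d₄) :
    ∃ K τ₀ : ℝ, 0 < K ∧ 0 < τ₀ ∧ d₁ * K / τ₀ ^ 2 + d₂ ≤ a * K ∧ 2 * (d₃ * K + d₄) ≤ τ₀ := by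
  obtain ⟨K, hK, hKpos⟩ : ∃ K : ℝ, d₂ ≤ a * K / 2 ∧ 0 < K :=
    ⟨2 * d₂ / a + 1, by field_simp; linarith, by positivity⟩
  obtain ⟨τ₀, h⟩ : ∃ τ₀ : ℝ, τ₀ = 1 + 2 * d₁ / a + 2 * (d₃ * K + d₄) := ⟨_, rfl⟩
  have h₁ : 0 ≤ 2 * d₁ / a := by positivity
  have h₂ : 0 ≤ 2 * (d₃ * K + d₄) := by positivity
  have hone : 1 ≤ τ₀ := by linarith
  refine ⟨K, τ₀, hKpos, by linarith, ?_, by linarith⟩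
  have h₃ : d₁ ≤ a / 2 * τ₀ := by
    have : 2 * d₁ / a ≤ τ₀ := by linarith
    rw [div_le_iff₀ ha] at this
    linarith
  have h₄ : d₁ * K / τ₀ ^ 2 ≤ a * K / 2 := by
    rw [div_le_iff₀ (by positivity)]
    calc d₁ * K ≤ a / 2 * τ₀ * K := by gcongr
      _ ≤ a / 2 * τ₀ ^ 2 * K := by gcongr; nlinarith
      _ = a * K / 2 * τ₀ ^ 2 := by ring
  linarith


/-- Existence and uniqueness of the decaying solution `φ_dec` of
`φ' = (diag(q, -q) + V(τ)) φ` on `[τ₀, ∞)` with `e^{qτ} φ(τ) → (0, 1)`, for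
`Re q > 0` and any perturbation `V` with entrywise bounds `d₁/τ², d₂/τ, d₃/τ,
d₄/τ²`; moreover the solution satisfies `e^{qτ} φ₁(τ) = O(1/τ)`. -/
theorem decaying_solution_exists_unique (q : ℂ) (hq : 0 < q.re)
    (d₁ d₂ d₃ d₄ : ℝ) (hd₁ : 0 ≤ d₁) (hd₂ : 0 ≤ d₂) (hd₃ : 0 ≤ d₃) (hd₄ : 0 ≤ d₄) :
    ∃ τ₀ : ℝ, 0 < τ₀ ∧
      ∀ V : ℝ → Matrix (Fin 2) (Fin 2) ℂ,
        ContinuousOn V (Set.Ici τ₀) →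
        (∀ τ : ℝ, τ₀ ≤ τ →
          ‖V τ 0 0‖ ≤ d₁ / τ ^ 2 ∧ ‖V τ 0 1‖ ≤ d₂ / τ ∧
          ‖V τ 1 0‖ ≤ d₃ / τ ∧ ‖V τ 1 1‖ ≤ d₄ / τ ^ 2) →
        (∃ φ : ℝ → Fin 2 → ℂ,
          (∀ τ ∈ Set.Ici τ₀,
            HasDerivWithinAt φ ((Matrix.diagonal ![q, -q] + V τ).mulVec (φ τ))
              (Set.Ici τ₀) τ) ∧
          Tendsto (fun τ : ℝ => Complex.exp (q * τ) • φ τ) atTop (nhds ![0, 1]) ∧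
          (fun τ : ℝ => Complex.exp (q * τ) * φ τ 0) =O[atTop] (fun τ : ℝ => 1 / τ)) ∧
        (∀ φ ψ : ℝ → Fin 2 → ℂ,
          (∀ τ ∈ Set.Ici τ₀,
            HasDerivWithinAt φ ((Matrix.diagonal ![q, -q] + V τ).mulVec (φ τ))
              (Set.Ici τ₀) τ) →
          Tendsto (fun τ : ℝ => Complex.exp (q * τ) • φ τ) atTop (nhds ![0, 1]) →
          (∀ τ ∈ Set.Ici τ₀,
            HasDerivWithinAt ψ ((Matrix.diagonal ![q, -q] + V τ).mulVec (ψ τ))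
              (Set.Ici τ₀) τ) →
          Tendsto (fun τ : ℝ => Complex.exp (q * τ) • ψ τ) atTop (nhds ![0, 1]) →
          Set.EqOn φ ψ (Set.Ici τ₀)) := by
  obtain ⟨K, τ₀, hK, hτ, h₁, h₂⟩ := exists_weight_and_start hq hd₁ hd₂ hd₃ hd₄
  refine ⟨τ₀, hτ, fun V hV bound => ?_⟩
  have B : WeightedBounds q V d₁ d₂ d₃ d₄ K τ₀ :=
    ⟨hq, hK, hd₁, hd₂, hd₃, hd₄, hτ, h₁, h₂, bound⟩
  exact ⟨B.existence hV, fun φ ψ hφ lφ hψ lψ => B.uniqueness hφ lφ hψ lψ⟩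
end

section
/- Let q ∈ ℂ with Re q > 0, let τ₀ > 0, c > 0, d₁, d₂, d₃, d₄ ≥ 0, and let V : [τ₀, ∞) → M₂(ℂ) be continuous with |V₁₁(τ)| ≤ d₁/τ², |V₁₂(τ)| ≤ d₂/τ, |V₂₁(τ)| ≤ d₃/τ, |V₂₂(τ)| ≤ d₄/τ². For continuous f : [τ₀, ∞) → ℂ² define δ(f) = sup_{τ≥τ₀} |f₂(τ)e^{qτ}|, κ(f) = sup_{τ≥τ₀} |τ·f₁(τ)e^{qτ}|, and the weighted norm ‖f‖_c = δ(f) + c·κ(f). Define the integral operator T by (Tf)₁(τ) = −∫_τ^∞ e^{(τ−y)q}·(V₁₁(y)f₁(y) + V₁₂(y)f₂(y)) dy and (Tf)₂(τ) = ∫_{τ₀}^τ e^{−(τ−y)q}·(V₂₁(y)f₁(y) + V₂₂(y)f₂(y)) dy. Then for every continuous f with ‖f‖_c < ∞, Tf is well defined and ‖Tf‖_c ≤ ( (c/(2 Re q))·(d₂ + d₁/(c·τ₀²)) + (1/τ₀)·(d₃/c + d₄) )·‖f‖_c. -/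
open MeasureTheory
open scoped ENNReal NNReal

/-- A function bounded by `M / y * e^{-ry}` stays integrable on `(τ, ∞)` against `e^{(τ-y)q}`,
`r = Re q`, and the integral, weighted by `τ e^{qτ}`, is at most `M / (2r)`. -/
theorem backward_green_integral {q : ℂ} (hq : 0 < q.re) {τ M : ℝ} (hτ : 0 < τ) (hM : 0 ≤ M)
    {g : ℝ → ℂ} (hg : ContinuousOn g (Set.Ici τ))
    (hb : ∀ y, τ ≤ y → ‖g y‖ ≤ M / y * Real.exp (-(q.re * y))) :
    IntegrableOn (fun y : ℝ => Complex.exp (((τ - y : ℝ) : ℂ) * q) * g y) (Set.Ioi τ) ∧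
    ‖(τ : ℂ) * (-(∫ y in Set.Ioi τ, Complex.exp (((τ - y : ℝ) : ℂ) * q) * g y))
      * Complex.exp (q * τ)‖ ≤ M / (2 * q.re) := by
  have hneg : -(2 * q.re) < 0 := by linarith
  have hint := (integrableOn_exp_mul_Ioi hneg τ).const_mul (M / τ * Real.exp (q.re * τ))
  have hle : ∀ y ∈ Set.Ioi τ, ‖Complex.exp (((τ - y : ℝ) : ℂ) * q) * g y‖ ≤
      M / τ * Real.exp (q.re * τ) * Real.exp (-(2 * q.re) * y) := by
    intro y hy
    have hy' : τ < y := hy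
    rw [norm_mul, Complex.norm_exp, Complex.re_ofReal_mul]
    calc Real.exp ((τ - y) * q.re) * ‖g y‖
        ≤ Real.exp ((τ - y) * q.re) * (M / τ * Real.exp (-(q.re * y))) := by
          gcongr
          exact (hb y hy'.le).trans (by gcongr)
      _ = M / τ * (Real.exp ((τ - y) * q.re) * Real.exp (-(q.re * y))) := by ring
      _ = M / τ * Real.exp (q.re * τ) * Real.exp (-(2 * q.re) * y) := by
          rw [mul_assoc, ← Real.exp_add, ← Real.exp_add]
          congr 2
          ring
  have hmeas : AEStronglyMeasurable (fun y : ℝ => Complex.exp (((τ - y : ℝ) : ℂ) * q) * g y)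
      (volume.restrict (Set.Ioi τ)) := by
    refine ContinuousOn.aestronglyMeasurable ?_ measurableSet_Ioi
    exact (Continuous.continuousOn (by fun_prop)).mul (hg.mono Set.Ioi_subset_Ici_self)
  have hae := ae_restrict_of_forall_mem (μ := volume) measurableSet_Ioi hle
  refine ⟨Integrable.mono' hint hmeas hae, ?_⟩
  have hI := norm_integral_le_of_norm_le hint hae
  rw [integral_const_mul, integral_exp_mul_Ioi hneg] at hI
  rw [norm_mul, norm_mul, norm_neg, Complex.norm_exp, Complex.re_mul_ofReal, Complex.norm_real,
    Real.norm_of_nonneg hτ.le]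
  calc _ ≤ τ * (M / τ * Real.exp (q.re * τ) *
          (-Real.exp (-(2 * q.re) * τ) / -(2 * q.re))) * Real.exp (q.re * τ) := by gcongr
    _ = M / (2 * q.re) *
          (Real.exp (q.re * τ) * Real.exp (-(2 * q.re) * τ) * Real.exp (q.re * τ)) := by
        field_simp
    _ = M / (2 * q.re) := by
        rw [← Real.exp_add, ← Real.exp_add]
        ring_nf
        simp

/-- A function bounded by `M / y² * e^{-ry}` is integrable on `[τ₀, τ]` against `e^{-(τ-y)q}`,
`r = Re q`, and the integral, weighted by `e^{qτ}`, is at most `M / τ₀`. -/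
theorem forward_green_integral {q : ℂ} {τ₀ τ M : ℝ} (hτ₀ : 0 < τ₀) (hτ : τ₀ ≤ τ) (hM : 0 ≤ M)
    {g : ℝ → ℂ} (hg : ContinuousOn g (Set.Ici τ₀))
    (hb : ∀ y, τ₀ ≤ y → ‖g y‖ ≤ M / y ^ 2 * Real.exp (-(q.re * y))) :
    IntervalIntegrable (fun y : ℝ => Complex.exp (-((τ - y : ℝ) : ℂ) * q) * g y) volume τ₀ τ ∧
    ‖(∫ y in τ₀..τ, Complex.exp (-((τ - y : ℝ) : ℂ) * q) * g y) * Complex.exp (q * τ)‖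
      ≤ M / τ₀ := by
  have hτpos : 0 < τ := hτ₀.trans_le hτ
  have h0 : (0 : ℝ) ∉ Set.uIcc τ₀ τ := by
    rw [Set.uIcc_of_le hτ]
    exact fun h => hτ₀.not_ge h.1
  constructor
  · apply ContinuousOn.intervalIntegrable
    rw [Set.uIcc_of_le hτ]
    exact (Continuous.continuousOn (by fun_prop)).mul (hg.mono Set.Icc_subset_Ici_self)
  have hint : IntervalIntegrable (fun y : ℝ => M * Real.exp (-(q.re * τ)) * y ^ (-2 : ℤ))
      volume τ₀ τ :=
    (intervalIntegral.intervalIntegrable_zpow (Or.inr h0)).const_mul _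
  have hle : ∀ y ∈ Set.Ioc τ₀ τ, ‖Complex.exp (-((τ - y : ℝ) : ℂ) * q) * g y‖ ≤
      M * Real.exp (-(q.re * τ)) * y ^ (-2 : ℤ) := by
    intro y hy
    rw [norm_mul, Complex.norm_exp, ← Complex.ofReal_neg, Complex.re_ofReal_mul]
    calc Real.exp (-(τ - y) * q.re) * ‖g y‖
        ≤ Real.exp (-(τ - y) * q.re) * (M / y ^ 2 * Real.exp (-(q.re * y))) := by
          gcongr
          exact hb y hy.1.le
      _ = M / y ^ 2 * (Real.exp (-(τ - y) * q.re) * Real.exp (-(q.re * y))) := by ring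
      _ = M / y ^ 2 * Real.exp (-(q.re * τ)) := by
          rw [← Real.exp_add]
          congr 2
          ring
      _ = M * Real.exp (-(q.re * τ)) * y ^ (-2 : ℤ) := by
          rw [zpow_neg, zpow_ofNat]
          ring
  have hI := intervalIntegral.norm_integral_le_of_norm_le hτ (Filter.Eventually.of_forall hle) hint
  rw [intervalIntegral.integral_const_mul, integral_zpow (Or.inr ⟨by norm_num, h0⟩)] at hI
  rw [norm_mul, Complex.norm_exp, Complex.re_mul_ofReal]
  calc _ ≤ M * Real.exp (-(q.re * τ)) *
          ((τ ^ (-2 + 1 : ℤ) - τ₀ ^ (-2 + 1 : ℤ)) / ((-2 : ℤ) + 1)) * Real.exp (q.re * τ) := by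
        gcongr
    _ = M * (τ₀⁻¹ - τ⁻¹) * (Real.exp (-(q.re * τ)) * Real.exp (q.re * τ)) := by
        norm_num
        ring
    _ = M * (τ₀⁻¹ - τ⁻¹) := by
        rw [← Real.exp_add]
        simp
    _ ≤ M / τ₀ := by
        rw [div_eq_mul_inv]
        gcongr
        exact sub_le_self _ (by positivity)

/-- Pointwise form of a finite `ℝ≥0∞`-valued supremum of norms. -/
theorem norm_le_toReal_iSup_nnnorm {ι E : Type*} [SeminormedAddGroup E] {u : ι → E}
    (h : (⨆ i, (‖u i‖₊ : ℝ≥0∞)) ≠ ⊤) (i : ι) : ‖u i‖ ≤ (⨆ i, (‖u i‖₊ : ℝ≥0∞)).toReal := by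
  simpa using ENNReal.toReal_mono h (le_iSup (fun i => (‖u i‖₊ : ℝ≥0∞)) i)

/-- A real bound on norms gives a bound on their `ℝ≥0∞`-valued supremum. -/
theorem iSup_nnnorm_le_ofReal {ι E : Type*} [SeminormedAddGroup E] {u : ι → E} {B : ℝ}
    (h : ∀ i, ‖u i‖ ≤ B) : (⨆ i, (‖u i‖₊ : ℝ≥0∞)) ≤ ENNReal.ofReal B := by
  refine iSup_le fun i => ?_
  rw [← enorm_eq_nnnorm, ← ofReal_norm]
  exact ENNReal.ofReal_le_ofReal (h i)

/-- Contraction bound for the Green-function integral operator `T = T_dec`: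
with the weighted norm `‖f‖_c = sup|f₂ e^{qτ}| + c · sup|τ f₁ e^{qτ}|`
(computed in `[0,∞]`), for any continuous `f` with `‖f‖_c < ∞` the operator
`(Tf)₁(τ) = -∫_τ^∞ e^{(τ-y)q}(V₁₁f₁ + V₁₂f₂) dy`,
`(Tf)₂(τ) = ∫_{τ₀}^τ e^{-(τ-y)q}(V₂₁f₁ + V₂₂f₂) dy` is well defined and
`‖Tf‖_c ≤ ((c/(2 Re q))(d₂ + d₁/(c τ₀²)) + (1/τ₀)(d₃/c + d₄)) ‖f‖_c`. -/
theorem green_operator_contraction_bound (q : ℂ) (hq : 0 < q.re)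
    (τ₀ c : ℝ) (hτ₀ : 0 < τ₀) (hc : 0 < c)
    (d₁ d₂ d₃ d₄ : ℝ) (hd₁ : 0 ≤ d₁) (hd₂ : 0 ≤ d₂) (hd₃ : 0 ≤ d₃) (hd₄ : 0 ≤ d₄)
    (V : ℝ → Matrix (Fin 2) (Fin 2) ℂ) (hV : ContinuousOn V (Set.Ici τ₀))
    (hVbound : ∀ τ : ℝ, τ₀ ≤ τ →
      ‖V τ 0 0‖ ≤ d₁ / τ ^ 2 ∧ ‖V τ 0 1‖ ≤ d₂ / τ ∧
      ‖V τ 1 0‖ ≤ d₃ / τ ∧ ‖V τ 1 1‖ ≤ d₄ / τ ^ 2)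
    (f : ℝ → Fin 2 → ℂ) (hf : ContinuousOn f (Set.Ici τ₀))
    (hfnorm :
      (⨆ τ : Set.Ici τ₀, (‖f τ 1 * Complex.exp (q * (τ : ℝ))‖₊ : ℝ≥0∞))
        + ENNReal.ofReal c *
          ⨆ τ : Set.Ici τ₀, (‖((τ : ℝ) : ℂ) * f τ 0 * Complex.exp (q * (τ : ℝ))‖₊ : ℝ≥0∞)
      < ⊤) :
    (∀ τ : ℝ, τ₀ ≤ τ →
      IntegrableOn
        (fun y : ℝ => Complex.exp (((τ - y : ℝ) : ℂ) * q) * (V y 0 0 * f y 0 + V y 0 1 * f y 1))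
        (Set.Ioi τ)) ∧
    (∀ τ : ℝ, τ₀ ≤ τ →
      IntervalIntegrable
        (fun y : ℝ => Complex.exp (-((τ - y : ℝ) : ℂ) * q) * (V y 1 0 * f y 0 + V y 1 1 * f y 1))
        volume τ₀ τ) ∧
    ((⨆ τ : Set.Ici τ₀,
        (‖(∫ y in (τ₀ : ℝ)..(τ : ℝ), Complex.exp (-(((τ : ℝ) - y : ℝ) : ℂ) * q) *
              (V y 1 0 * f y 0 + V y 1 1 * f y 1))
            * Complex.exp (q * (τ : ℝ))‖₊ : ℝ≥0∞))
      + ENNReal.ofReal c *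
        ⨆ τ : Set.Ici τ₀,
          (‖((τ : ℝ) : ℂ) *
              (-(∫ y in Set.Ioi (τ : ℝ), Complex.exp ((((τ : ℝ) - y : ℝ) : ℂ) * q) *
                  (V y 0 0 * f y 0 + V y 0 1 * f y 1)))
              * Complex.exp (q * (τ : ℝ))‖₊ : ℝ≥0∞)
      ≤ ENNReal.ofReal ((c / (2 * q.re)) * (d₂ + d₁ / (c * τ₀ ^ 2)) + (1 / τ₀) * (d₃ / c + d₄)) *
        ((⨆ τ : Set.Ici τ₀, (‖f τ 1 * Complex.exp (q * (τ : ℝ))‖₊ : ℝ≥0∞))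
          + ENNReal.ofReal c *
            ⨆ τ : Set.Ici τ₀,
              (‖((τ : ℝ) : ℂ) * f τ 0 * Complex.exp (q * (τ : ℝ))‖₊ : ℝ≥0∞))) := by
  set δ : ℝ≥0∞ := ⨆ τ : Set.Ici τ₀, (‖f τ 1 * Complex.exp (q * (τ : ℝ))‖₊ : ℝ≥0∞)
  set κ : ℝ≥0∞ := ⨆ τ : Set.Ici τ₀,
    (‖((τ : ℝ) : ℂ) * f τ 0 * Complex.exp (q * (τ : ℝ))‖₊ : ℝ≥0∞)
  have hδtop : δ ≠ ⊤ := (ENNReal.add_lt_top.1 hfnorm).1.ne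
  have hκtop : κ ≠ ⊤ := by
    intro h
    have h2 := (ENNReal.add_lt_top.1 hfnorm).2
    rw [h, ENNReal.mul_top (ENNReal.ofReal_pos.2 hc).ne'] at h2
    exact lt_irrefl _ h2
  set D := δ.toReal
  set K := κ.toReal
  have hD : 0 ≤ D := ENNReal.toReal_nonneg
  have hK : 0 ≤ K := ENNReal.toReal_nonneg
  have hf₁ : ∀ y, τ₀ ≤ y → ‖f y 1‖ ≤ D * Real.exp (-(q.re * y)) := by
    intro y hy
    have h := norm_le_toReal_iSup_nnnorm hδtop ⟨y, hy⟩
    rw [norm_mul, Complex.norm_exp, Complex.re_mul_ofReal] at h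
    rwa [Real.exp_neg, ← div_eq_mul_inv, le_div_iff₀ (Real.exp_pos _)]
  have hf₀ : ∀ y, τ₀ ≤ y → ‖f y 0‖ ≤ K / y * Real.exp (-(q.re * y)) := by
    intro y hy
    have hy0 : 0 < y := hτ₀.trans_le hy
    have h := norm_le_toReal_iSup_nnnorm hκtop ⟨y, hy⟩
    rw [norm_mul, norm_mul, Complex.norm_exp, Complex.re_mul_ofReal, Complex.norm_real,
      Real.norm_of_nonneg hy0.le] at h
    rw [Real.exp_neg, ← div_eq_mul_inv, le_div_iff₀ (Real.exp_pos _), le_div_iff₀ hy0]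
    linarith
  have hVc : ∀ i j, ContinuousOn (fun y => V y i j) (Set.Ici τ₀) := fun i j =>
    (continuous_id.matrix_elem i j).comp_continuousOn hV
  have hfc : ∀ i, ContinuousOn (fun y => f y i) (Set.Ici τ₀) := fun i =>
    (continuous_apply i).comp_continuousOn hf
  have hgc : ∀ i, ContinuousOn (fun y => V y i 0 * f y 0 + V y i 1 * f y 1) (Set.Ici τ₀) :=
    fun i => ((hVc i 0).mul (hfc 0)).add ((hVc i 1).mul (hfc 1))
  have hb₀ : ∀ y, τ₀ ≤ y → ‖V y 0 0 * f y 0 + V y 0 1 * f y 1‖ ≤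
      (d₁ * K / τ₀ ^ 2 + d₂ * D) / y * Real.exp (-(q.re * y)) := by
    intro y hy
    have hy0 : 0 < y := hτ₀.trans_le hy
    obtain ⟨h₁, h₂, -, -⟩ := hVbound y hy
    calc _ ≤ ‖V y 0 0‖ * ‖f y 0‖ + ‖V y 0 1‖ * ‖f y 1‖ := by
          simpa only [norm_mul] using norm_add_le (V y 0 0 * f y 0) (V y 0 1 * f y 1)
      _ ≤ d₁ / τ₀ ^ 2 * (K / y * Real.exp (-(q.re * y))) +
            d₂ / y * (D * Real.exp (-(q.re * y))) := by
          gcongr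
          · exact h₁.trans (by gcongr)
          · exact hf₀ y hy
          · exact hf₁ y hy
      _ = _ := by ring
  have hb₁ : ∀ y, τ₀ ≤ y → ‖V y 1 0 * f y 0 + V y 1 1 * f y 1‖ ≤
      (d₃ * K + d₄ * D) / y ^ 2 * Real.exp (-(q.re * y)) := by
    intro y hy
    have hy0 : 0 < y := hτ₀.trans_le hy
    obtain ⟨-, -, h₃, h₄⟩ := hVbound y hy
    calc _ ≤ ‖V y 1 0‖ * ‖f y 0‖ + ‖V y 1 1‖ * ‖f y 1‖ := by
          simpa only [norm_mul] using norm_add_le (V y 1 0 * f y 0) (V y 1 1 * f y 1)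
      _ ≤ d₃ / y * (K / y * Real.exp (-(q.re * y))) +
            d₄ / y ^ 2 * (D * Real.exp (-(q.re * y))) := by
          gcongr
          · exact hf₀ y hy
          · exact hf₁ y hy
      _ = _ := by
          field_simp
  have hback := fun τ (hτ : τ₀ ≤ τ) => backward_green_integral hq (hτ₀.trans_le hτ)
    (by positivity) ((hgc 0).mono (Set.Ici_subset_Ici.2 hτ)) fun y hy => hb₀ y (hτ.trans hy)
  have hforw := fun τ (hτ : τ₀ ≤ τ) => forward_green_integral hτ₀ hτ (by positivity) (hgc 1) hb₁
  refine ⟨fun τ hτ => (hback τ hτ).1, fun τ hτ => (hforw τ hτ).1, ?_⟩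
  calc _ ≤ ENNReal.ofReal ((d₃ * K + d₄ * D) / τ₀) + ENNReal.ofReal c *
        ENNReal.ofReal ((d₁ * K / τ₀ ^ 2 + d₂ * D) / (2 * q.re)) := by
        gcongr
        · exact iSup_nnnorm_le_ofReal fun τ => (hforw τ τ.2).2
        · exact iSup_nnnorm_le_ofReal fun τ => (hback τ τ.2).2
    _ = ENNReal.ofReal ((d₃ * K + d₄ * D) / τ₀ +
        c * ((d₁ * K / τ₀ ^ 2 + d₂ * D) / (2 * q.re))) := by
        rw [← ENNReal.ofReal_mul hc.le, ← ENNReal.ofReal_add (by positivity) (by positivity)]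
    _ ≤ ENNReal.ofReal (((c / (2 * q.re)) * (d₂ + d₁ / (c * τ₀ ^ 2)) +
        (1 / τ₀) * (d₃ / c + d₄)) * (D + c * K)) := by
        apply ENNReal.ofReal_le_ofReal
        have hslack : 0 ≤ c / (2 * q.re) * (d₂ * (c * K) + d₁ / (c * τ₀ ^ 2) * D) +
            1 / τ₀ * (d₃ / c * D + d₄ * (c * K)) := by positivity
        refine le_of_sub_nonneg (hslack.trans_eq ?_)
        field_simp
        ring
    _ = _ := by
        rw [ENNReal.ofReal_mul (by positivity), ENNReal.ofReal_add hD (by positivity),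
          ENNReal.ofReal_mul hc.le, ENNReal.ofReal_toReal hδtop, ENNReal.ofReal_toReal hκtop]
end

section
/- Let V be a complex vector space, F : ℤ → V and β : ℤ → ℂ be such that: F₀ and F₁ are linearly independent; F_{k+1} = F_{k−1} + β_k·F_k for all k ∈ ℤ; β_{k+3} = β_k for all k; F_{k+6} = −F_k for all k; and for every k there is a scalar c_k ∈ ℂ with F_{k+3} = c_k·F_k. Then there exists c ∈ ℂ with c² = −1 such that β_k = c for all k ∈ ℤ and F_{k+3} = c·F_k for all k ∈ ℤ. -/
section ThreeTermRecurrence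

variable {K V : Type*} [Field K] [AddCommGroup V] [Module K V] {F : ℤ → V} {β : ℤ → K}

/-- A three-term recurrence propagates linear independence of consecutive terms. -/
lemma linearIndependent_succ_of_recurrence
    (hrec : ∀ k : ℤ, F (k + 1) = F (k - 1) + β k • F k) {k : ℤ}
    (hind : LinearIndependent K ![F k, F (k + 1)]) :
    LinearIndependent K ![F (k + 1), F (k + 2)] := by
  have h2 : F (k + 2) = F k + β (k + 1) • F (k + 1) := by
    convert hrec (k + 1) using 2 <;> ring_nf
  rw [LinearIndependent.pair_iff] at hind ⊢
  intro s t hst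
  obtain ⟨rfl, hs⟩ := hind t (s + t * β (k + 1)) (by rw [← hst, h2]; module)
  exact ⟨by simpa using hs, rfl⟩

/-- Three steps of the recurrence, expressed in terms of the two initial terms. -/
lemma recurrence_add_three
    (hrec : ∀ k : ℤ, F (k + 1) = F (k - 1) + β k • F k) (k : ℤ) :
    F (k + 3) = β (k + 2) • F k + (1 + β (k + 1) * β (k + 2)) • F (k + 1) := by
  have h2 : F (k + 2) = F k + β (k + 1) • F (k + 1) := by
    convert hrec (k + 1) using 2 <;> ring_nf
  have h3 : F (k + 3) = F (k + 1) + β (k + 2) • F (k + 2) := by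
    convert hrec (k + 2) using 2 <;> ring_nf
  rw [h3, h2]
  module

/-- If `F (k + 3)` is proportional to `F k`, then consecutive coefficients multiply to `-1`. -/
lemma coeff_mul_coeff_eq_neg_one
    (hrec : ∀ k : ℤ, F (k + 1) = F (k - 1) + β k • F k) {k : ℤ}
    (hind : LinearIndependent K ![F k, F (k + 1)]) (hF3 : ∃ c : K, F (k + 3) = c • F k) :
    β (k + 1) * β (k + 2) = -1 := by
  obtain ⟨c, hc⟩ := hF3
  rw [recurrence_add_three hrec, ← sub_eq_zero] at hc
  have h := (LinearIndependent.pair_iff.1 hind (β (k + 2) - c)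
    (1 + β (k + 1) * β (k + 2)) (by rw [← hc]; module)).2
  linear_combination h

end ThreeTermRecurrence

/-- The algebraic core of the Stokes-coefficient computation: if `F₀, F₁` are
linearly independent, `F_{k+1} = F_{k-1} + β_k F_k`, `β_{k+3} = β_k`,
`F_{k+6} = -F_k`, and each `F_{k+3}` is proportional to `F_k`, then there is a
`c` with `c² = -1` such that `β_k = c` and `F_{k+3} = c F_k` for all `k`. -/
theorem stokes_coefficients_airy (V : Type*) [AddCommGroup V] [Module ℂ V]
    (F : ℤ → V) (β : ℤ → ℂ)
    (hind : LinearIndependent ℂ ![F 0, F 1])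
    (hrec : ∀ k : ℤ, F (k + 1) = F (k - 1) + β k • F k)
    (hβ : ∀ k : ℤ, β (k + 3) = β k)
    (hF6 : ∀ k : ℤ, F (k + 6) = -F k)
    (hF3 : ∀ k : ℤ, ∃ c : ℂ, F (k + 3) = c • F k) :
    ∃ c : ℂ, c ^ 2 = -1 ∧ (∀ k : ℤ, β k = c) ∧ ∀ k : ℤ, F (k + 3) = c • F k := by
  have hind1 : LinearIndependent ℂ ![F 1, F 2] :=
    linearIndependent_succ_of_recurrence (k := 0) hrec hind
  have hind2 : LinearIndependent ℂ ![F 2, F 3] :=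
    linearIndependent_succ_of_recurrence (k := 1) hrec hind1
  have h12 : β 1 * β 2 = -1 := coeff_mul_coeff_eq_neg_one (k := 0) hrec hind (hF3 0)
  have h23 : β 2 * β 3 = -1 := coeff_mul_coeff_eq_neg_one (k := 1) hrec hind1 (hF3 1)
  have h34 : β 3 * β 4 = -1 := coeff_mul_coeff_eq_neg_one (k := 2) hrec hind2 (hF3 2)
  have h30 : β 3 = β 0 := hβ 0
  have h41 : β 4 = β 1 := hβ 1
  rw [h30] at h23 h34
  rw [h41] at h34
  have h10 : β 1 = β 0 := by linear_combination (-β 0) * h12 + β 1 * h23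
  have h20 : β 2 = β 0 := by linear_combination (-β 0) * h12 + β 2 * h34
  have hsq : β 0 ^ 2 = -1 := by rw [h10] at h34; linear_combination h34
  have hconst : ∀ k, β k = β 0 := by
    intro k
    have hper : Function.Periodic β 3 := hβ
    have hmod : β k = β (k % 3) := by
      conv_lhs => rw [← Int.emod_add_mul_ediv k 3, mul_comm]
      exact hper.int_mul (k / 3) (k % 3)
    rw [hmod]
    have h0 := Int.emod_nonneg k (b := 3) (by norm_num)
    have h3 := Int.emod_lt_of_pos k (b := 3) (by norm_num)
    generalize k % 3 = r at h0 h3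
    interval_cases r <;> simp [h10, h20]
  refine ⟨β 0, hsq, hconst, fun k => ?_⟩
  rw [recurrence_add_three hrec, hconst (k + 1), hconst (k + 2), ← sq, hsq]
  simp
end

section
/- Let q ∈ ℂ with Re q > 0 and d₁, d₂, d₃, d₄ ≥ 0. Then there exists τ₀ > 0 such that for every continuous V : [τ₀, ∞) → M₂(ℂ) with |V₁₁(τ)| ≤ d₁/τ², |V₁₂(τ)| ≤ d₂/τ, |V₂₁(τ)| ≤ d₃/τ, |V₂₂(τ)| ≤ d₄/τ², the set of differentiable solutions ψ : [τ₀, ∞) → ℂ² of ψ'(τ) = (diag(q, −q) + V(τ))·ψ(τ) satisfying ψ(τ) → 0 as τ → ∞ is exactly the one-dimensional space ℂ·φ_dec, where φ_dec is the unique solution with e^{qτ}·φ_dec(τ) → (0, 1) as τ → ∞. In particular, any solution decaying at infinity is a constant multiple of φ_dec. -/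
open Filter

open MeasureTheory Set Topology BoundedContinuousFunction

/-- A function with vanishing one-sided derivative on a half-line is constant there. -/
lemma eq_left_of_hasDerivWithinAt_zero {f : ℝ → ℂ} {a : ℝ}
    (hf : ∀ t ∈ Ici a, HasDerivWithinAt f 0 (Ici a) t) {t : ℝ} (ht : a ≤ t) : f t = f a := by
  refine constant_of_has_deriv_right_zero (b := t) (fun x hx => ?_) (fun x hx => ?_) t ⟨ht, le_rfl⟩
  · exact ((hf x hx.1).continuousWithinAt).mono Icc_subset_Ici_self
  · exact (hf x hx.1).mono (Ici_subset_Ici.2 hx.1)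

lemma Continuous.integrableOn_Ioi_of_integrableOn_Ioi {f : ℝ → ℂ} (hf : Continuous f) {a : ℝ}
    (hi : IntegrableOn f (Ioi a)) (b : ℝ) : IntegrableOn f (Ioi b) := by
  refine ((hf.integrableOn_Icc (a := b) (b := a)).union hi).mono_set fun x hx => ?_
  rcases le_or_gt x a with h | h
  · exact Or.inl ⟨le_of_lt hx, h⟩
  · exact Or.inr h

/-- The fundamental theorem of calculus for the tail integral of a continuous function. -/
lemma Continuous.hasDerivAt_integral_Ioi {f : ℝ → ℂ} (hf : Continuous f) {a : ℝ}
    (hi : IntegrableOn f (Ioi a)) (t : ℝ) :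
    HasDerivAt (fun τ => ∫ s in Ioi τ, f s) (-f t) t := by
  have h : (fun τ => ∫ s in Ioi τ, f s) = fun τ => (∫ s in Ioi a, f s) - ∫ s in a..τ, f s := by
    funext τ
    rw [← intervalIntegral.integral_interval_add_Ioi hi
      (hf.integrableOn_Ioi_of_integrableOn_Ioi hi τ)]
    ring
  rw [h]
  exact (hf.integral_hasStrictDerivAt a t).hasDerivAt.const_sub _

lemma integrableOn_Ioi_const_div_sq {a : ℝ} (ha : 0 < a) (M : ℝ) :
    IntegrableOn (fun s : ℝ => M / s ^ 2) (Ioi a) := by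
  have h : IntegrableOn (fun s : ℝ => M * s ^ (-2 : ℝ)) (Ioi a) :=
    (integrableOn_Ioi_rpow_of_lt (by norm_num) ha).const_mul M
  refine h.congr_fun (fun s hs => ?_) measurableSet_Ioi
  have : (0 : ℝ) < s := ha.trans hs
  simp [Real.rpow_neg this.le, div_eq_mul_inv]

lemma integral_Ioi_const_div_sq {a : ℝ} (ha : 0 < a) (M : ℝ) :
    ∫ s in Ioi a, M / s ^ 2 = M / a := by
  have h : ∫ s in Ioi a, M / s ^ 2 = ∫ s in Ioi a, M * s ^ (-2 : ℝ) := by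
    refine setIntegral_congr_fun measurableSet_Ioi fun s hs => ?_
    have : (0 : ℝ) < s := ha.trans hs
    simp [Real.rpow_neg this.le, div_eq_mul_inv]
  rw [h, integral_const_mul, integral_Ioi_rpow_of_lt (by norm_num) ha]
  norm_num [Real.rpow_neg_one, div_eq_mul_inv]

lemma integrableOn_Ioi_of_norm_le_div_sq {f : ℝ → ℂ} (hf : Continuous f) {a M : ℝ} (ha : 0 < a)
    (hb : ∀ s, a ≤ s → ‖f s‖ ≤ M / s ^ 2) : IntegrableOn f (Ioi a) :=
  (integrableOn_Ioi_const_div_sq ha M).mono' hf.aestronglyMeasurable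
    ((ae_restrict_iff' measurableSet_Ioi).2 (.of_forall fun s hs => hb s (le_of_lt hs)))

lemma norm_integral_Ioi_le_of_norm_le_div_sq {f : ℝ → ℂ} {a M : ℝ} (ha : 0 < a)
    (hb : ∀ s, a ≤ s → ‖f s‖ ≤ M / s ^ 2) {t : ℝ} (ht : a ≤ t) :
    ‖∫ s in Ioi t, f s‖ ≤ M / t := by
  rw [← integral_Ioi_const_div_sq (ha.trans_le ht)]
  exact norm_integral_le_of_norm_le (integrableOn_Ioi_const_div_sq (ha.trans_le ht) M)
    ((ae_restrict_iff' measurableSet_Ioi).2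
      (.of_forall fun s hs => hb s (ht.trans (le_of_lt hs))))

lemma tendsto_zero_of_norm_le_const_div {f : ℝ → ℂ} {a M : ℝ} (hb : ∀ t, a ≤ t → ‖f t‖ ≤ M / t) :
    Tendsto f atTop (𝓝 0) :=
  squeeze_zero_norm' ((eventually_ge_atTop a).mono hb) (tendsto_const_nhds.div_atTop tendsto_id)

/-- A solution of a scalar linear equation with coefficient `O(t⁻²)` that tends to zero vanishes. -/
lemma eq_zero_of_hasDerivWithinAt_mul {g D : ℝ → ℂ} (hg : Continuous g) {a M : ℝ} (ha : 0 < a)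
    (hb : ∀ s, a ≤ s → ‖g s‖ ≤ M / s ^ 2)
    (hD : ∀ t ∈ Ici a, HasDerivWithinAt D (g t * D t) (Ici a) t)
    (hlim : Tendsto D atTop (𝓝 0)) {t : ℝ} (ht : a ≤ t) : D t = 0 := by
  have hi := integrableOn_Ioi_of_norm_le_div_sq hg ha hb
  set E : ℝ → ℂ := fun τ => D τ * Complex.exp (∫ s in Ioi τ, g s) with hE
  have hconst : ∀ τ, a ≤ τ → E τ = E a := fun τ hτ => by
    refine eq_left_of_hasDerivWithinAt_zero (fun r hr => ?_) hτ
    refine ((hD r hr).mul (hg.hasDerivAt_integral_Ioi hi r).cexp.hasDerivWithinAt).congr_deriv ?_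
    ring
  have hElim : Tendsto E atTop (𝓝 0) := by
    have h0 : Tendsto (fun τ => ∫ s in Ioi τ, g s) atTop (𝓝 0) :=
      tendsto_zero_of_norm_le_const_div fun τ hτ => norm_integral_Ioi_le_of_norm_le_div_sq ha hb hτ
    simpa using hlim.mul ((Complex.continuous_exp.tendsto 0).comp h0)
  have hEa : E a = 0 := tendsto_nhds_unique
    (tendsto_const_nhds.congr' ((eventually_ge_atTop a).mono fun τ hτ => (hconst τ hτ).symm)) hElim
  simpa [hE, Complex.exp_ne_zero] using (hconst t ht).trans hEa

/-- A linear integral equation `v = 1 - ∫ₜ^∞ F v` whose kernel is `O(s⁻²)` with a small constant is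
solvable by contraction. -/
lemma exists_eq_one_sub_integral_Ioi {F : (ℝ →ᵇ ℂ) → ℝ → ℂ} (hF : ∀ v, Continuous (F v))
    (hsub : ∀ v w s, F (v - w) s = F v s - F w s) {a M : ℝ} (ha : 0 < a)
    (hMa : 3 * M ≤ a) (hb : ∀ v s, a ≤ s → ‖F v s‖ ≤ M * ‖v‖ / s ^ 2) :
    ∃ v : ℝ →ᵇ ℂ, (∀ t, a ≤ t → v t = 1 - ∫ s in Ioi t, F v s) ∧
      ∀ t, a ≤ t → v t ≠ 0 := by
  have hi := fun v => integrableOn_Ioi_of_norm_le_div_sq (hF v) ha (hb v)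
  have hbound : ∀ v t, a ≤ t → ‖∫ s in Ioi t, F v s‖ ≤ 1 / 3 * ‖v‖ := fun v t ht => by
    refine (norm_integral_Ioi_le_of_norm_le_div_sq ha (hb v) ht).trans ?_
    rw [div_le_iff₀ (ha.trans_le ht)]
    nlinarith [norm_nonneg v]
  have hcont : ∀ v, Continuous fun t => ∫ s in Ioi (max a t), F v s := fun v =>
    (continuous_iff_continuousAt.2 fun t =>
      ((hF v).hasDerivAt_integral_Ioi (hi v) t).continuousAt).comp
      (continuous_const.max continuous_id)
  let K : (ℝ →ᵇ ℂ) → (ℝ →ᵇ ℂ) := fun v =>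
    BoundedContinuousFunction.ofNormedAddCommGroup (fun t => ∫ s in Ioi (max a t), F v s) (hcont v)
      (1 / 3 * ‖v‖) fun t => hbound v _ (le_max_left _ _)
  have hK : ∀ v, ‖K v‖ ≤ 1 / 3 * ‖v‖ := fun v =>
    BoundedContinuousFunction.norm_ofNormedAddCommGroup_le _ (by positivity) _
  have hKsub : ∀ v w, K v - K w = K (v - w) := fun v w => by
    ext t
    change (∫ s in Ioi (max a t), F v s) - (∫ s in Ioi (max a t), F w s) =
      ∫ s in Ioi (max a t), F (v - w) s
    rw [← integral_sub ((hi v).mono_set (Ioi_subset_Ioi (le_max_left _ _)))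
      ((hi w).mono_set (Ioi_subset_Ioi (le_max_left _ _)))]
    simp_rw [hsub]
  have hT : ContractingWith (1 / 3) fun v => 1 - K v := by
    refine ⟨by rw [← NNReal.coe_lt_coe]; norm_num, LipschitzWith.of_dist_le_mul fun v w => ?_⟩
    rw [dist_eq_norm, dist_eq_norm, sub_sub_sub_cancel_left, hKsub, norm_sub_rev v w]
    simpa using hK (w - v)
  obtain ⟨v, hv⟩ : ∃ v, 1 - K v = v := ⟨_, hT.fixedPoint_isFixedPt⟩
  have hvt : ∀ t, a ≤ t → v t = 1 - ∫ s in Ioi t, F v s := fun t ht => by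
    conv_lhs => rw [← hv]
    change 1 - (∫ s in Ioi (max a t), F v s) = _
    rw [max_eq_right ht]
  have hvn : ‖v‖ ≤ 1 + 1 / 3 * ‖v‖ := by
    conv_lhs => rw [← hv]
    refine (norm_sub_le _ _).trans (add_le_add ?_ (hK v))
    simp
  refine ⟨v, hvt, fun t ht h0 => ?_⟩
  have h1 : (∫ s in Ioi t, F v s) = 1 := by
    rw [hvt t ht] at h0
    exact (sub_eq_zero.1 h0).symm
  have h2 := hbound v t ht
  rw [h1, norm_one] at h2
  linarith

/-- For `Re q > 0` the equation `u' = (2q + α) u + β v` with `α = O(t⁻²)`, `β = O(t⁻¹)` and bounded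
`v` has a solution of size `O(t⁻¹)` depending linearly on `v`. -/
lemma exists_decaying_particular_solution {q : ℂ} (hq : 0 < q.re) {α β : ℝ → ℂ}
    (hα : Continuous α) (hβ : Continuous β) {a d₁ d₂ : ℝ} (ha : 0 < a)
    (hd₂ : 0 ≤ d₂) (hda : d₁ ≤ a)
    (hαb : ∀ s, a ≤ s → ‖α s‖ ≤ d₁ / s ^ 2) (hβb : ∀ s, a ≤ s → ‖β s‖ ≤ d₂ / s) :
    ∃ L : (ℝ →ᵇ ℂ) → ℝ → ℂ,
      (∀ v t, HasDerivAt (L v) ((2 * q + α t) * L v t + β t * v t) t) ∧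
      (∀ v w t, L (v - w) t = L v t - L w t) ∧
      ∀ v t, a ≤ t → ‖L v t‖ ≤ Real.exp 2 * d₂ / (2 * q.re) * ‖v‖ / t := by
  set G : ℝ → ℂ := fun τ => ∫ s in Ioi τ, α s
  have hGd : ∀ t, HasDerivAt G (-α t) t :=
    hα.hasDerivAt_integral_Ioi (integrableOn_Ioi_of_norm_le_div_sq hα ha hαb)
  have hGb : ∀ t, a ≤ t → |(G t).re| ≤ 1 := fun t ht => by
    refine (Complex.abs_re_le_norm _).trans
      ((norm_integral_Ioi_le_of_norm_le_div_sq ha hαb ht).trans ?_)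
    rw [div_le_one (ha.trans_le ht)]
    exact hda.trans ht
  set p : ℝ → ℂ := fun t => Complex.exp (-(2 * q) * t + G t) with hp
  have hpd : ∀ t, HasDerivAt p (-(2 * q + α t) * p t) t := fun t => by
    have h1 : HasDerivAt (fun t : ℝ => -(2 * q) * (t : ℂ)) (-(2 * q)) t := by
      simpa using (Complex.ofRealCLM.hasDerivAt (x := t)).const_mul (-(2 * q))
    exact (h1.add (hGd t)).cexp.congr_deriv (by simp only [hp, Pi.add_apply]; ring)
  have hpc : Continuous p := continuous_iff_continuousAt.2 fun t => (hpd t).continuousAt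
  have hp0 : ∀ t, p t ≠ 0 := fun t => Complex.exp_ne_zero _
  have hpn : ∀ t, ‖p t‖ = Real.exp (-(2 * q.re) * t + (G t).re) := fun t => by
    simp [hp, Complex.norm_exp]
  have hq2 : -(2 * q.re) < 0 := by linarith
  have hfb : ∀ (v : ℝ →ᵇ ℂ) t, a ≤ t → ∀ s ∈ Ioi t, ‖p s * β s * v s‖ ≤
      Real.exp 1 * (d₂ / t) * ‖v‖ * Real.exp (-(2 * q.re) * s) := fun v t ht s hs => by
    have hts : t ≤ s := le_of_lt hs
    have ht0 := ha.trans_le ht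
    have e1 : ‖p s‖ ≤ Real.exp 1 * Real.exp (-(2 * q.re) * s) := by
      rw [hpn, ← Real.exp_add]
      exact Real.exp_le_exp.2 (by linarith [(abs_le.1 (hGb s (ht.trans hts))).2])
    have e2 : ‖β s‖ ≤ d₂ / t := (hβb s (ht.trans hts)).trans (by gcongr)
    calc ‖p s * β s * v s‖ = ‖p s‖ * ‖β s‖ * ‖v s‖ := by simp
      _ ≤ Real.exp 1 * Real.exp (-(2 * q.re) * s) * (d₂ / t) * ‖v‖ := by
        gcongr
        exact v.norm_coe_le_norm s
      _ = _ := by ring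
  have hfc : ∀ v : ℝ →ᵇ ℂ, Continuous fun s => p s * β s * v s := fun v =>
    (hpc.mul hβ).mul v.continuous
  have hfi : ∀ v : ℝ →ᵇ ℂ, IntegrableOn (fun s => p s * β s * v s) (Ioi a) := fun v =>
    ((integrableOn_exp_mul_Ioi hq2 a).const_mul _).mono' (hfc v).aestronglyMeasurable
      ((ae_restrict_iff' measurableSet_Ioi).2 (.of_forall (hfb v a le_rfl)))
  refine ⟨fun v t => -(∫ s in Ioi t, p s * β s * v s) / p t, fun v t => ?_, fun v w t => ?_,
    fun v t ht => ?_⟩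
  · refine (((hfc v).hasDerivAt_integral_Ioi (hfi v) t).fun_neg.fun_div (hpd t) (hp0 t)).congr_deriv
      ?_
    have := hp0 t
    field_simp
    ring
  · have h : ∀ v : ℝ →ᵇ ℂ, IntegrableOn (fun s => p s * β s * v s) (Ioi t) := fun v =>
      (hfc v).integrableOn_Ioi_of_integrableOn_Ioi (hfi v) t
    have e : (∫ s in Ioi t, p s * β s * (v - w) s) =
        (∫ s in Ioi t, p s * β s * v s) - ∫ s in Ioi t, p s * β s * w s := by
      rw [← integral_sub (h v) (h w)]
      simp [mul_sub]
    change -(∫ s in Ioi t, p s * β s * (v - w) s) / p t = _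
    rw [e]
    ring
  · have ht0 := ha.trans_le ht
    have h1 := norm_integral_le_of_norm_le
      ((integrableOn_exp_mul_Ioi hq2 t).const_mul (Real.exp 1 * (d₂ / t) * ‖v‖))
      ((ae_restrict_iff' measurableSet_Ioi).2 (.of_forall (hfb v t ht)))
    rw [integral_const_mul, integral_exp_mul_Ioi hq2] at h1
    have h2 : Real.exp (-(2 * q.re) * t) ≤ Real.exp 1 * ‖p t‖ := by
      rw [hpn, ← Real.exp_add]
      exact Real.exp_le_exp.2 (by linarith [(abs_le.1 (hGb t ht)).1])
    rw [norm_div, norm_neg, div_le_iff₀ (norm_pos_iff.2 (hp0 t))]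
    have e2 : Real.exp 2 = Real.exp 1 * Real.exp 1 := by rw [← Real.exp_add]; norm_num
    calc _ ≤ _ := h1
      _ = Real.exp 1 * (d₂ / t) * ‖v‖ / (2 * q.re) * Real.exp (-(2 * q.re) * t) := by
        field_simp
      _ ≤ Real.exp 1 * (d₂ / t) * ‖v‖ / (2 * q.re) * (Real.exp 1 * ‖p t‖) := by gcongr
      _ = _ := by rw [e2]; ring

/-- For coefficients of the stated size, the system conjugated by `e^{qt}` has a solution tending to
`(0, 1)` whose second component never vanishes. -/
lemma exists_solution_tendsto_zero_one {q : ℂ} (hq : 0 < q.re) {α β γ δ : ℝ → ℂ}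
    (hα : Continuous α) (hβ : Continuous β) (hγ : Continuous γ) (hδ : Continuous δ)
    {a d₁ d₂ d₃ d₄ : ℝ} (ha : 0 < a) (hd₂ : 0 ≤ d₂) (hd₃ : 0 ≤ d₃) (hda : d₁ ≤ a)
    (hsmall : 3 * (d₃ * (Real.exp 2 * d₂ / (2 * q.re)) + d₄) ≤ a)
    (hαb : ∀ s, a ≤ s → ‖α s‖ ≤ d₁ / s ^ 2) (hβb : ∀ s, a ≤ s → ‖β s‖ ≤ d₂ / s)
    (hγb : ∀ s, a ≤ s → ‖γ s‖ ≤ d₃ / s) (hδb : ∀ s, a ≤ s → ‖δ s‖ ≤ d₄ / s ^ 2) :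
    ∃ u v : ℝ → ℂ,
      (∀ t, a ≤ t → HasDerivAt u ((2 * q + α t) * u t + β t * v t) t) ∧
      (∀ t, a ≤ t → HasDerivAt v (γ t * u t + δ t * v t) t) ∧
      Tendsto u atTop (𝓝 0) ∧ Tendsto v atTop (𝓝 1) ∧ ∀ t, a ≤ t → v t ≠ 0 := by
  obtain ⟨L, hLd, hLsub, hLb⟩ := exists_decaying_particular_solution hq hα hβ ha hd₂ hda hαb hβb
  set C := Real.exp 2 * d₂ / (2 * q.re)
  set F : (ℝ →ᵇ ℂ) → ℝ → ℂ := fun v s => γ s * L v s + δ s * v s with hF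
  have hFc : ∀ v, Continuous (F v) := fun v =>
    (hγ.mul (continuous_iff_continuousAt.2 fun t => (hLd v t).continuousAt)).add
      (hδ.mul v.continuous)
  have hFb : ∀ v s, a ≤ s → ‖F v s‖ ≤ (d₃ * C + d₄) * ‖v‖ / s ^ 2 := fun v s hs => by
    have hs0 := ha.trans_le hs
    have hδ0 : 0 ≤ d₄ / s ^ 2 := (norm_nonneg _).trans (hδb s hs)
    calc ‖F v s‖ ≤ ‖γ s‖ * ‖L v s‖ + ‖δ s‖ * ‖v s‖ := by
          simpa only [norm_mul] using norm_add_le (γ s * L v s) (δ s * v s)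
      _ ≤ d₃ / s * (C * ‖v‖ / s) + d₄ / s ^ 2 * ‖v‖ := by
          gcongr
          · exact hγb s hs
          · exact hLb v s hs
          · exact hδb s hs
          · exact v.norm_coe_le_norm s
      _ = _ := by field_simp
  obtain ⟨v, hv, hv0⟩ := exists_eq_one_sub_integral_Ioi hFc
    (fun v w s => by simp only [hF, hLsub, BoundedContinuousFunction.coe_sub, Pi.sub_apply]; ring)
    ha hsmall hFb
  have hi := integrableOn_Ioi_of_norm_le_div_sq (hFc v) ha (hFb v)
  refine ⟨L v, fun t => 1 - ∫ s in Ioi t, F v s, fun t ht => ?_, fun t ht => ?_, ?_, ?_,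
    fun t ht => ?_⟩
  · simpa only [← hv t ht] using hLd v t
  · refine (((hFc v).hasDerivAt_integral_Ioi hi t).const_sub 1).congr_deriv ?_
    beta_reduce
    rw [neg_neg, ← hv t ht]
  · exact tendsto_zero_of_norm_le_const_div (hLb v)
  · have h0 : Tendsto (fun t => ∫ s in Ioi t, F v s) atTop (𝓝 0) :=
      tendsto_zero_of_norm_le_const_div fun t ht =>
        norm_integral_Ioi_le_of_norm_le_div_sq ha (hFb v) ht
    simpa using h0.const_sub 1
  · simpa only [← hv t ht] using hv0 t ht

lemma hasDerivWithinAt_diagonal_add_mulVec_iff {q : ℂ} {A : Matrix (Fin 2) (Fin 2) ℂ}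
    {ψ : ℝ → Fin 2 → ℂ} {s : Set ℝ} {t : ℝ} :
    HasDerivWithinAt ψ ((Matrix.diagonal ![q, -q] + A).mulVec (ψ t)) s t ↔
      HasDerivWithinAt (fun τ => ψ τ 0) ((q + A 0 0) * ψ t 0 + A 0 1 * ψ t 1) s t ∧
      HasDerivWithinAt (fun τ => ψ τ 1) (A 1 0 * ψ t 0 + (-q + A 1 1) * ψ t 1) s t := by
  rw [hasDerivWithinAt_pi, Fin.forall_fin_two]
  simp [Matrix.mulVec, dotProduct, Fin.sum_univ_two]

lemma tendsto_cexp_neg_mul_atTop {q : ℂ} (hq : 0 < q.re) :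
    Tendsto (fun t : ℝ => Complex.exp (-(q * t))) atTop (𝓝 0) := by
  rw [tendsto_zero_iff_norm_tendsto_zero]
  simp only [Complex.norm_exp, Complex.neg_re, Complex.re_mul_ofReal]
  exact Real.tendsto_exp_neg_atTop_nhds_zero.comp (tendsto_id.const_mul_atTop hq)

lemma tendsto_zero_of_tendsto_cexp_smul {q : ℂ} (hq : 0 < q.re) {φ : ℝ → Fin 2 → ℂ}
    {c : Fin 2 → ℂ} (h : Tendsto (fun t : ℝ => Complex.exp (q * t) • φ t) atTop (𝓝 c)) :
    Tendsto φ atTop (𝓝 0) := by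
  simpa [smul_smul, ← Complex.exp_add] using (tendsto_cexp_neg_mul_atTop hq).smul h

/-- Two solutions of a planar linear system which both tend to zero are proportional as soon as
the trace is `O(t⁻²)` and one of them has nonvanishing second component: their Wronskian vanishes. -/
lemma exists_eqOn_smul_of_tendsto_zero {q : ℂ} {a M : ℝ} (ha : 0 < a)
    {V : ℝ → Matrix (Fin 2) (Fin 2) ℂ} (hV : ContinuousOn V (Ici a))
    (htr : ∀ s, a ≤ s → ‖V s 0 0 + V s 1 1‖ ≤ M / s ^ 2) {φ ψ : ℝ → Fin 2 → ℂ}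
    (hφ : ∀ t ∈ Ici a,
      HasDerivWithinAt φ ((Matrix.diagonal ![q, -q] + V t).mulVec (φ t)) (Ici a) t)
    (hψ : ∀ t ∈ Ici a,
      HasDerivWithinAt ψ ((Matrix.diagonal ![q, -q] + V t).mulVec (ψ t)) (Ici a) t)
    (hφ0 : Tendsto φ atTop (𝓝 0)) (hψ0 : Tendsto ψ atTop (𝓝 0)) (hne : ∀ t, a ≤ t → φ t 1 ≠ 0) :
    ∃ k : ℂ, EqOn ψ (fun t => k • φ t) (Ici a) := by
  simp only [hasDerivWithinAt_diagonal_add_mulVec_iff] at hφ hψ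
  have hVm : Continuous fun t => V (max a t) :=
    hV.comp_continuous (continuous_const.max continuous_id) fun t => le_max_left a t
  have hW : ∀ t, a ≤ t → ψ t 0 * φ t 1 - ψ t 1 * φ t 0 = 0 := fun t ht => by
    refine eq_zero_of_hasDerivWithinAt_mul
      (g := fun t => V (max a t) 0 0 + V (max a t) 1 1) (D := fun t => ψ t 0 * φ t 1 - ψ t 1 * φ t 0)
      ((hVm.matrix_elem 0 0).add (hVm.matrix_elem 1 1)) ha
      (fun s hs => by simpa only [max_eq_right hs] using htr s hs) (fun s hs => ?_) ?_ ht
    · refine (((hψ s hs).1.mul (hφ s hs).2).sub ((hψ s hs).2.mul (hφ s hs).1)).congr_deriv ?_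
      rw [max_eq_right hs]
      ring
    · rw [tendsto_pi_nhds] at hφ0 hψ0
      simpa using ((hψ0 0).mul (hφ0 1)).sub ((hψ0 1).mul (hφ0 0))
  have hk : ∀ t, a ≤ t → ψ t 1 / φ t 1 = ψ a 1 / φ a 1 := fun t ht => by
    refine eq_left_of_hasDerivWithinAt_zero (f := fun t => ψ t 1 / φ t 1) (fun s hs => ?_) ht
    refine ((hψ s hs).2.div (hφ s hs).2 (hne s hs)).congr_deriv ?_
    rw [div_eq_zero_iff]
    left
    linear_combination V s 1 0 * hW s hs
  refine ⟨ψ a 1 / φ a 1, fun t ht => ?_⟩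
  have h1 := hne t ht
  funext i
  fin_cases i
  · change ψ t 0 = ψ a 1 / φ a 1 * φ t 0
    rw [← hk t ht]
    field_simp
    linear_combination hW t ht
  · change ψ t 1 = ψ a 1 / φ a 1 * φ t 1
    rw [← hk t ht]
    field_simp

/-- In an Exact Stokes Sector (`Re q > 0`), the decaying solutions of
`ψ' = (diag(q, -q) + V(τ)) ψ` on `[τ₀, ∞)` form exactly the one-dimensional
space of constant multiples of the distinguished solution `φ_dec`, the unique
solution with `e^{qτ} φ_dec(τ) → (0, 1)`. -/
theorem decaying_solutions_one_dimensional (q : ℂ) (hq : 0 < q.re)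
    (d₁ d₂ d₃ d₄ : ℝ) (hd₁ : 0 ≤ d₁) (hd₂ : 0 ≤ d₂) (hd₃ : 0 ≤ d₃) (hd₄ : 0 ≤ d₄) :
    ∃ τ₀ : ℝ, 0 < τ₀ ∧
      ∀ V : ℝ → Matrix (Fin 2) (Fin 2) ℂ,
        ContinuousOn V (Set.Ici τ₀) →
        (∀ τ : ℝ, τ₀ ≤ τ →
          ‖V τ 0 0‖ ≤ d₁ / τ ^ 2 ∧ ‖V τ 0 1‖ ≤ d₂ / τ ∧
          ‖V τ 1 0‖ ≤ d₃ / τ ∧ ‖V τ 1 1‖ ≤ d₄ / τ ^ 2) →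
        ∃ φdec : ℝ → Fin 2 → ℂ,
          ((∀ τ ∈ Set.Ici τ₀,
              HasDerivWithinAt φdec ((Matrix.diagonal ![q, -q] + V τ).mulVec (φdec τ))
                (Set.Ici τ₀) τ) ∧
            Tendsto (fun τ : ℝ => Complex.exp (q * τ) • φdec τ) atTop (nhds ![0, 1])) ∧
          (∀ φ : ℝ → Fin 2 → ℂ,
            (∀ τ ∈ Set.Ici τ₀,
              HasDerivWithinAt φ ((Matrix.diagonal ![q, -q] + V τ).mulVec (φ τ))
                (Set.Ici τ₀) τ) →
            Tendsto (fun τ : ℝ => Complex.exp (q * τ) • φ τ) atTop (nhds ![0, 1]) →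
            Set.EqOn φ φdec (Set.Ici τ₀)) ∧
          (∀ ψ : ℝ → Fin 2 → ℂ,
            ((∀ τ ∈ Set.Ici τ₀,
                HasDerivWithinAt ψ ((Matrix.diagonal ![q, -q] + V τ).mulVec (ψ τ))
                  (Set.Ici τ₀) τ) ∧
              Tendsto ψ atTop (nhds 0))
            ↔ ∃ k : ℂ, Set.EqOn ψ (fun τ => k • φdec τ) (Set.Ici τ₀)) := by
  set C := Real.exp 2 * d₂ / (2 * q.re)
  have hC0 : 0 ≤ C := by positivity
  have hdC : 0 ≤ d₃ * C := mul_nonneg hd₃ hC0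
  refine ⟨1 + d₁ + 3 * (d₃ * C + d₄), by positivity, ?_⟩
  set τ₀ := 1 + d₁ + 3 * (d₃ * C + d₄)
  have hpos : 0 < τ₀ := by positivity
  intro V hV hVb
  have hVm : Continuous fun t => V (max τ₀ t) :=
    hV.comp_continuous (continuous_const.max continuous_id) fun t => le_max_left τ₀ t
  obtain ⟨u, v, hu, hv, hu0, hv1, hvne⟩ := exists_solution_tendsto_zero_one hq
    (hVm.matrix_elem 0 0) (hVm.matrix_elem 0 1) (hVm.matrix_elem 1 0) (hVm.matrix_elem 1 1)
    (d₁ := d₁) (d₂ := d₂) (d₃ := d₃) (d₄ := d₄) hpos hd₂ hd₃ (by linarith) (by linarith)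
    (fun s hs => by simpa only [max_eq_right hs] using (hVb s hs).1)
    (fun s hs => by simpa only [max_eq_right hs] using (hVb s hs).2.1)
    (fun s hs => by simpa only [max_eq_right hs] using (hVb s hs).2.2.1)
    (fun s hs => by simpa only [max_eq_right hs] using (hVb s hs).2.2.2)
  set φdec : ℝ → Fin 2 → ℂ := fun t => Complex.exp (-(q * t)) • ![u t, v t] with hφdec
  have hsol : ∀ τ ∈ Set.Ici τ₀,
      HasDerivWithinAt φdec ((Matrix.diagonal ![q, -q] + V τ).mulVec (φdec τ))
        (Set.Ici τ₀) τ := fun t ht => by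
    have he : HasDerivAt (fun t : ℝ => Complex.exp (-(q * t))) (-q * Complex.exp (-(q * t))) t := by
      have h1 : HasDerivAt (fun t : ℝ => -(q * (t : ℂ))) (-q) t := by
        simpa using ((Complex.ofRealCLM.hasDerivAt (x := t)).const_mul q).fun_neg
      exact h1.cexp.congr_deriv (by ring)
    have hu' := hu t ht
    have hv' := hv t ht
    simp only [max_eq_right (Set.mem_Ici.1 ht)] at hu' hv'
    refine hasDerivWithinAt_diagonal_add_mulVec_iff.2 ⟨?_, ?_⟩
    · refine (he.mul hu').hasDerivWithinAt.congr_deriv ?_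
      simp [hφdec]
      ring
    · refine (he.mul hv').hasDerivWithinAt.congr_deriv ?_
      simp [hφdec]
      ring
  have hlim : Tendsto (fun τ : ℝ => Complex.exp (q * τ) • φdec τ) atTop (nhds ![0, 1]) := by
    simp only [hφdec, smul_smul, ← Complex.exp_add, add_neg_cancel, Complex.exp_zero, one_smul]
    rw [tendsto_pi_nhds, Fin.forall_fin_two]
    exact ⟨hu0, hv1⟩
  have hdec0 := tendsto_zero_of_tendsto_cexp_smul hq hlim
  have hprop := fun (ψ : ℝ → Fin 2 → ℂ) hψ hψ0 => exists_eqOn_smul_of_tendsto_zero (ψ := ψ)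
    (M := d₁ + d₄) hpos hV
    (fun s hs => (norm_add_le _ _).trans
      ((add_le_add (hVb s hs).1 (hVb s hs).2.2.2).trans_eq (add_div _ _ _).symm))
    hsol hψ hdec0 hψ0 fun t ht => mul_ne_zero (Complex.exp_ne_zero _) (hvne t ht)
  refine ⟨φdec, ⟨hsol, hlim⟩, fun φ hφ hφlim => ?_, fun ψ => ⟨fun h => hprop ψ h.1 h.2, ?_⟩⟩
  · obtain ⟨k, hk⟩ := hprop φ hφ (tendsto_zero_of_tendsto_cexp_smul hq hφlim)
    have hklim : Tendsto (fun τ : ℝ => Complex.exp (q * τ) • φ τ) atTop (nhds (k • ![0, 1])) := by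
      refine (hlim.const_smul k).congr' ((eventually_ge_atTop τ₀).mono fun t ht => ?_)
      simp only [hk (Set.mem_Ici.2 ht), smul_comm k]
    have hk1 : k = 1 := by
      simpa using congrFun (tendsto_nhds_unique hklim hφlim) 1
    intro t ht
    simpa [hk1] using hk ht
  · rintro ⟨k, hk⟩
    refine ⟨fun t ht => ?_, ?_⟩
    · refine (((hsol t ht).const_smul k).congr hk (hk ht)).congr_deriv ?_
      simp only [hk ht, Matrix.mulVec_smul]
    · have h := hdec0.const_smul k
      rw [smul_zero] at h
      exact h.congr' ((eventually_ge_atTop τ₀).mono fun t ht => (hk ht).symm)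
end
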